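/- There exist absolute constants c > 0, e > 0 and c' > 0 such that the following holds. Let P ∈ ℝ[x,y] be irreducible of degree d ≥ 2 with P_x ≠ 0 and P_y ≠ 0, let Γ = {(x,y) ∈ ℝ² : P(x,y) = 0}, let k > 1 be an integer, set r = μ(k) = (k+1)(k+2)/2, and let Γ° be a connected component of (Γ ∩ [0,1]²) \ Π_r. Then for every real H ≥ 2 there exist an integer N ≤ c·k^e·H^{c'/k} and nonzero polynomials Q_1,…,Q_N ∈ ℝ[x,y], each of degree at most k, such that every point of Γ°(ℚ,H) lies on the zero set of some Q_i. -/

import Mathlib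

open MvPolynomial Topology

/-- Evaluation of a polynomial in two variables at a point of `ℝ²`. -/
noncomputable def evalRR (Q : MvPolynomial (Fin 2) ℝ) (p : ℝ × ℝ) : ℝ :=
  MvPolynomial.eval ![p.1, p.2] Q

/-- The field `ℝ(x,y)` of rational functions in two variables. -/
abbrev RatFunc2 : Type := FractionRing (MvPolynomial (Fin 2) ℝ)

/-- The inclusion `ℝ[x,y] → ℝ(x,y)`. -/
noncomputable def toRF : MvPolynomial (Fin 2) ℝ →+* RatFunc2 :=
  algebraMap (MvPolynomial (Fin 2) ℝ) RatFunc2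

/-- `p` is an isolated point of the set `S ⊆ ℝ²`. -/
def IsIsolatedIn (p : ℝ × ℝ) (S : Set (ℝ × ℝ)) : Prop :=
  p ∈ S ∧ 𝓝[S \ {p}] p = ⊥

/-- The set `Π_r ⊆ Γ = {P = 0}`: points of `Γ` that are isolated zeros on `Γ` of one of
the polynomials `P_x, P_y, P_x ± P_y, x ± 1, y ± 1`, or `y_{xj}, x_{yj}` for `j = 0, …, r`. -/
def PiSet (P : MvPolynomial (Fin 2) ℝ) (r : ℕ)
    (yx xy : ℕ → MvPolynomial (Fin 2) ℝ) : Set (ℝ × ℝ) :=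
  {p | evalRR P p = 0 ∧ ∃ g : MvPolynomial (Fin 2) ℝ,
    (g = pderiv 0 P ∨ g = pderiv 1 P ∨
      g = pderiv 0 P + pderiv 1 P ∨ g = pderiv 0 P - pderiv 1 P ∨
      g = X 0 + 1 ∨ g = X 0 - 1 ∨ g = X 1 + 1 ∨ g = X 1 - 1 ∨
      ∃ j ≤ r, g = yx j ∨ g = xy j) ∧
    IsIsolatedIn p ({q | evalRR g q = 0} ∩ {q | evalRR P q = 0})}

/-- The height of a rational number `q = a/b` in lowest terms is `max (|a|, b)`. -/
def ratHeight (q : ℚ) : ℕ := max q.num.natAbs q.den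



/-! ### Part 1: algebra -/

section PartOne
open Polynomial

lemma exists_const_mem {R : Type*} [CommRing R] [IsDomain R] [UniqueFactorizationMonoid R]
    (P g : R[X]) (hP : Irreducible P) (hg : ¬ P ∣ g) :
    ∃ (h : R) (a b : R[X]), h ≠ 0 ∧ Polynomial.C h = a * P + b * g := by
  classical
  by_cases hdeg : P.natDegree = 0
  · obtain ⟨c, hc⟩ := Polynomial.natDegree_eq_zero.1 hdeg
    refine ⟨c, 1, 0, ?_, by simp [hc]⟩
    rintro rfl
    apply hP.ne_zero
    rw [← hc]; simp
  · have hprim := hP.isPrimitive hdeg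
    let _ : GCDMonoid R := UniqueFactorizationMonoid.toGCDMonoid R
    have hK : Irreducible (P.map (algebraMap R (FractionRing R))) :=
      (hprim.irreducible_iff_irreducible_map_fraction_map (K := FractionRing R)).1 hP
    have hinj : Function.Injective (Polynomial.map (algebraMap R (FractionRing R))) :=
      Polynomial.map_injective _ (IsFractionRing.injective R (FractionRing R))
    have clear : ∀ u : (FractionRing R)[X], ∃ (s : R) (u' : R[X]), s ≠ 0 ∧
        u'.map (algebraMap R (FractionRing R)) = Polynomial.C (algebraMap R (FractionRing R) s) * u := by
      intro u
      obtain ⟨b, hb0, hb⟩ := IsLocalization.integerNormalization_spec (nonZeroDivisors R) u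
      refine ⟨b, IsLocalization.integerNormalization (nonZeroDivisors R) u, nonZeroDivisors.ne_zero hb0, ?_⟩
      rw [hb, Algebra.smul_def]
      rfl
    by_cases hd : P.map (algebraMap R (FractionRing R)) ∣ g.map (algebraMap R (FractionRing R))
    · exfalso
      obtain ⟨m, hm⟩ := hd
      obtain ⟨s, m', hs, hm'⟩ := clear m
      have : Polynomial.C s * g = P * m' := by
        apply hinj
        simp only [Polynomial.map_mul, Polynomial.map_C, hm, hm']
        ring
      have hpr : Prime P := hP.prime
      have h1 : P ∣ Polynomial.C s * g := ⟨_, this⟩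
      rcases hpr.dvd_or_dvd h1 with h2 | h2
      · apply hdeg
        have := Polynomial.natDegree_le_of_dvd h2 (by simpa using hs)
        simpa using this
      · exact hg h2
    · have hc : IsCoprime (P.map (algebraMap R (FractionRing R))) (g.map (algebraMap R (FractionRing R))) :=
        (hK.coprime_iff_not_dvd).2 hd
      obtain ⟨u, v, huv⟩ := hc
      obtain ⟨s, u', hs, hu⟩ := clear u
      obtain ⟨t, v', ht, hv⟩ := clear v
      refine ⟨s * t, Polynomial.C t * u', Polynomial.C s * v', mul_ne_zero hs ht, ?_⟩
      apply hinj
      simp only [Polynomial.map_mul, Polynomial.map_C, Polynomial.map_add, hu, hv, map_mul]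
      linear_combination (-(Polynomial.C (algebraMap R (FractionRing R) s)) * Polynomial.C (algebraMap R (FractionRing R) t)) * huv

end PartOne

lemma finite_zeros_one (h : MvPolynomial (Fin 1) ℝ) (hh : h ≠ 0) :
    {y : ℝ | MvPolynomial.eval (fun _ => y) h = 0}.Finite := by
  have hne : MvPolynomial.aeval (fun _ : Fin 1 => (Polynomial.X : Polynomial ℝ)) h ≠ 0 := by
    intro h0
    apply hh
    have h1 := congrArg (Polynomial.aeval (X 0 : MvPolynomial (Fin 1) ℝ)) h0
    rw [map_zero, ← AlgHom.comp_apply] at h1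
    have h2 : (Polynomial.aeval (X 0 : MvPolynomial (Fin 1) ℝ)).comp
        (MvPolynomial.aeval (fun _ : Fin 1 => (Polynomial.X : Polynomial ℝ))) = AlgHom.id ℝ _ := by
      apply MvPolynomial.algHom_ext
      intro i
      fin_cases i
      simp
    rw [h2] at h1
    simpa using h1
  refine (Polynomial.finite_setOfPred_isRoot hne).subset ?_
  intro y hy
  simp only [Set.mem_ofPred_eq, Polynomial.IsRoot] at hy ⊢
  rw [← hy]
  have : ((Polynomial.aeval y).comp
      (MvPolynomial.aeval (fun _ : Fin 1 => (Polynomial.X : Polynomial ℝ)))) =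
      (MvPolynomial.aeval (fun _ => y) : MvPolynomial (Fin 1) ℝ →ₐ[ℝ] ℝ) := by
    apply MvPolynomial.algHom_ext
    intro i
    simp
  have h3 := congrArg (fun φ => φ h) this
  simpa [Polynomial.coe_aeval_eq_eval, MvPolynomial.aeval_eq_eval] using h3

lemma finite_snd (P g : MvPolynomial (Fin 2) ℝ) (hP : Irreducible P) (hg : ¬ P ∣ g) :
    ∃ Z : Set ℝ, Z.Finite ∧ ∀ p, evalRR P p = 0 → evalRR g p = 0 → p.2 ∈ Z := by
  let φ := MvPolynomial.finSuccEquiv ℝ 1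
  have hP' : Irreducible (φ P) := (MulEquiv.irreducible_iff φ).2 hP
  have hg' : ¬ φ P ∣ φ g := by
    intro h; exact hg ((map_dvd_iff φ).1 h)
  obtain ⟨h, a, b, hh, hab⟩ := exists_const_mem (φ P) (φ g) hP' hg'
  refine ⟨_, finite_zeros_one h hh, ?_⟩
  rintro ⟨x, y⟩ h1 h2
  have key : ∀ Q : MvPolynomial (Fin 2) ℝ, evalRR Q (x, y) =
      Polynomial.eval x (Polynomial.map (MvPolynomial.eval (fun _ : Fin 1 => y)) (φ Q)) := by
    intro Q
    unfold evalRR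
    have h0 := MvPolynomial.eval_eq_eval_mv_eval' (fun _ : Fin 1 => y) x Q
    rw [← h0]
    congr 1
    congr 1
    funext i
    fin_cases i <;> rfl
  rw [key] at h1 h2
  have h3 := congrArg (fun q => Polynomial.eval x (Polynomial.map (MvPolynomial.eval (fun _ : Fin 1 => y)) q)) hab
  simp only [Polynomial.map_add, Polynomial.map_mul, Polynomial.eval_add, Polynomial.eval_mul, h1, h2,
    Polynomial.map_C, Polynomial.eval_C, mul_zero, add_zero] at h3
  exact h3

lemma finite_common (P g : MvPolynomial (Fin 2) ℝ) (hP : Irreducible P) (hg : ¬ P ∣ g) :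
    ({q | evalRR g q = 0} ∩ {q | evalRR P q = 0}).Finite := by
  obtain ⟨Z, hZ, hZ'⟩ := finite_snd P g hP hg
  let σ := MvPolynomial.renameEquiv ℝ (Equiv.swap (0 : Fin 2) 1)
  have hev : ∀ (Q : MvPolynomial (Fin 2) ℝ) (x y : ℝ), evalRR (σ Q) (y, x) = evalRR Q (x, y) := by
    intro Q x y
    simp only [evalRR, σ, MvPolynomial.renameEquiv_apply, MvPolynomial.eval_rename]
    congr 1
    congr 1
    funext i
    fin_cases i <;> simp
  obtain ⟨W, hW, hW'⟩ := finite_snd (σ P) (σ g) ((MulEquiv.irreducible_iff σ).2 hP)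
    (fun h => hg ((map_dvd_iff σ).1 h))
  refine (hW.prod hZ).subset ?_
  rintro ⟨x, y⟩ ⟨h1, h2⟩
  refine ⟨hW' (y, x) ?_ ?_, hZ' (x, y) h2 h1⟩
  · rw [hev]; exact h2
  · rw [hev]; exact h1

lemma isolated_of_finite (p : ℝ × ℝ) (S : Set (ℝ × ℝ)) (hS : S.Finite) (hp : p ∈ S) :
    IsIsolatedIn p S := by
  refine ⟨hp, ?_⟩
  rw [← Filter.not_neBot, ← mem_closure_iff_nhdsWithin_neBot]
  rw [(hS.subset Set.sdiff_subset).isClosed.closure_eq]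
  simp


/-! ### Part 2: connected components are graphs -/

lemma evalRR_add (Q R : MvPolynomial (Fin 2) ℝ) (p : ℝ × ℝ) :
    evalRR (Q + R) p = evalRR Q p + evalRR R p := by simp [evalRR]

lemma evalRR_sub (Q R : MvPolynomial (Fin 2) ℝ) (p : ℝ × ℝ) :
    evalRR (Q - R) p = evalRR Q p - evalRR R p := by simp [evalRR]

lemma evalRR_mul (Q R : MvPolynomial (Fin 2) ℝ) (p : ℝ × ℝ) :
    evalRR (Q * R) p = evalRR Q p * evalRR R p := by simp [evalRR]

lemma strict_evalRR (Q : MvPolynomial (Fin 2) ℝ) (p : ℝ × ℝ) :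
    HasStrictFDerivAt (evalRR Q) ((evalRR (pderiv 0 Q) p) • ContinuousLinearMap.fst ℝ ℝ ℝ +
      (evalRR (pderiv 1 Q) p) • ContinuousLinearMap.snd ℝ ℝ ℝ) p := by
  induction Q using MvPolynomial.induction_on with
  | C a =>
    have : evalRR (C a : MvPolynomial (Fin 2) ℝ) = fun _ => a := by
      funext q; simp [evalRR]
    rw [this]
    refine (hasStrictFDerivAt_const a p).congr_fderiv ?_
    simp [evalRR]
  | add Q R hQ hR =>
    have : evalRR (Q + R) = fun q => evalRR Q q + evalRR R q := by
      funext q; exact evalRR_add Q R q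
    rw [this]
    refine (hQ.add hR).congr_fderiv ?_
    simp only [map_add, evalRR_add]
    module
  | mul_X Q i hQ =>
    have : evalRR (Q * X i) = fun q => evalRR Q q * evalRR (X i) q := by
      funext q; exact evalRR_mul Q _ q
    rw [this]
    have hX : HasStrictFDerivAt (evalRR (X i)) ((evalRR (pderiv 0 (X i)) p) • ContinuousLinearMap.fst ℝ ℝ ℝ +
      (evalRR (pderiv 1 (X i)) p) • ContinuousLinearMap.snd ℝ ℝ ℝ) p := by
      fin_cases i
      · have : evalRR (X 0 : MvPolynomial (Fin 2) ℝ) = Prod.fst := by funext q; simp [evalRR]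
        change HasStrictFDerivAt (evalRR (X 0)) (evalRR (pderiv 0 (X 0)) p • _ + evalRR (pderiv 1 (X 0)) p • _) p
        rw [this]
        refine (hasStrictFDerivAt_fst (𝕜 := ℝ) (E := ℝ) (F := ℝ) (p := p)).congr_fderiv ?_
        simp [evalRR, pderiv_X]
      · have : evalRR (X 1 : MvPolynomial (Fin 2) ℝ) = Prod.snd := by funext q; simp [evalRR]
        change HasStrictFDerivAt (evalRR (X 1)) (evalRR (pderiv 0 (X 1)) p • _ + evalRR (pderiv 1 (X 1)) p • _) p
        rw [this]
        refine (hasStrictFDerivAt_snd (𝕜 := ℝ) (E := ℝ) (F := ℝ) (p := p)).congr_fderiv ?_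
        simp [evalRR, pderiv_X]
    refine (hQ.mul hX).congr_fderiv ?_
    simp only [Derivation.leibniz, smul_eq_mul, evalRR_add, evalRR_mul]
    module

lemma continuous_evalRR (Q : MvPolynomial (Fin 2) ℝ) : Continuous (evalRR Q) :=
  continuous_iff_continuousAt.2 fun p => (strict_evalRR Q p).continuousAt

lemma deriv_evalRR (Q : MvPolynomial (Fin 2) ℝ) (f : ℝ → ℝ) (f' x : ℝ) (hf : HasDerivAt f f' x) :
    HasDerivAt (fun t => evalRR Q (t, f t))
      (evalRR (pderiv 0 Q) (x, f x) + evalRR (pderiv 1 Q) (x, f x) * f') x := by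
  have h1 : HasDerivAt (fun t => (t, f t)) ((1 : ℝ), f') x := (hasDerivAt_id x).prodMk hf
  have h2 := (strict_evalRR Q (x, f x)).hasFDerivAt.comp_hasDerivAt x h1
  refine h2.congr_deriv ?_
  simp

lemma implicit_local (P : MvPolynomial (Fin 2) ℝ) (p : ℝ × ℝ) (hp : evalRR P p = 0)
    (hy : evalRR (pderiv 1 P) p ≠ 0) :
    ∃ g : ℝ → ℝ, (∀ᶠ q in 𝓝 p, evalRR P q = 0 ↔ g q.1 = q.2) ∧
      (∀ᶠ x in 𝓝 p.1, ContinuousAt g x) ∧ g p.1 = p.2 ∧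
      (∀ᶠ x in 𝓝 p.1, evalRR P (x, g x) = 0) ∧
      HasDerivAt g (-(evalRR (pderiv 0 P) p / evalRR (pderiv 1 P) p)) p.1 := by
  have hs := strict_evalRR P p
  set A := evalRR (pderiv 0 P) p
  set B := evalRR (pderiv 1 P) p
  have hinv : (((A • ContinuousLinearMap.fst ℝ ℝ ℝ + B • ContinuousLinearMap.snd ℝ ℝ ℝ)) ∘L
      .inr ℝ ℝ ℝ).IsInvertible := by
    refine ⟨ContinuousLinearEquiv.unitsEquivAut ℝ (Units.mk0 B hy), ?_⟩
    ext
    simp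
  have h1 := hs.eventually_apply_eq_iff_implicitFunctionOfProdDomain hinv
  have h2 := hs.hasStrictFDerivAt_implicitFunctionOfProdDomain hinv
  have h3 := hs.eventually_apply_implicitFunctionOfProdDomain hinv
  set g := hs.implicitFunctionOfProdDomain hinv
  rw [hp] at h1 h3
  refine ⟨g, h1, ?_, ?_, h3, ?_⟩
  · obtain ⟨K, s, hs, hK⟩ := h2.exists_lipschitzOnWith
    have := eventually_mem_nhds_iff.2 hs
    filter_upwards [this] with x hx
    exact hK.continuousOn.continuousAt hx
  · exact (h1.self_of_nhds).1 hp
  · have hg0 : g p.1 = p.2 := (h1.self_of_nhds).1 hp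
    have hd := h2.hasFDerivAt.hasDerivAt
    set D := (-((A • ContinuousLinearMap.fst ℝ ℝ ℝ + B • ContinuousLinearMap.snd ℝ ℝ ℝ) ∘L ContinuousLinearMap.inr ℝ ℝ ℝ).inverse ∘L
          ((A • ContinuousLinearMap.fst ℝ ℝ ℝ + B • ContinuousLinearMap.snd ℝ ℝ ℝ) ∘L ContinuousLinearMap.inl ℝ ℝ ℝ)) 1
    have h4 := deriv_evalRR P g D p.1 hd
    have h5 : HasDerivAt (fun t => evalRR P (t, g t)) 0 p.1 :=
      (hasDerivAt_const p.1 (0 : ℝ)).congr_of_eventuallyEq h3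
    have h6 := h4.unique h5
    rw [hg0] at h6
    have : D = -(A / B) := by
      change A + B * D = 0 at h6
      field_simp
      linarith
    rw [← this]; exact hd

/-- two points joined by a section of the first projection -/
def SecJoin (S : Set (ℝ × ℝ)) (p q : ℝ × ℝ) : Prop :=
  ∃ (I : Set ℝ) (s : ℝ → ℝ), IsOpen I ∧ IsPreconnected I ∧ ContinuousOn s I ∧
    (∀ x ∈ I, (x, s x) ∈ S) ∧ p.1 ∈ I ∧ q.1 ∈ I ∧ s p.1 = p.2 ∧ s q.1 = q.2

lemma section_unique (P : MvPolynomial (Fin 2) ℝ) (W : Set (ℝ × ℝ))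
    (hWy : ∀ p ∈ W, evalRR (pderiv 1 P) p ≠ 0)
    (K : Set ℝ) (hK : IsPreconnected K) (hKo : IsOpen K) (s t : ℝ → ℝ) (hs : ContinuousOn s K)
    (ht : ContinuousOn t K)
    (hsS : ∀ x ∈ K, (x, s x) ∈ {p | evalRR P p = 0} ∩ W)
    (htS : ∀ x ∈ K, (x, t x) ∈ {p | evalRR P p = 0} ∩ W) (x y : ℝ) (hx : x ∈ K) (hy : y ∈ K)
    (hxy : s x = t x) : s y = t y := by
  have := hK.induction₂ (fun x y => (s x = t x ↔ s y = t y)) ?_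
    (fun x y z _ _ _ h1 h2 => h1.trans h2) (fun x y _ _ h => h.symm) hx hy
  · exact this.1 hxy
  · intro z hz
    have hsc : ContinuousAt s z := hs.continuousAt (hKo.mem_nhds hz)
    have htc : ContinuousAt t z := ht.continuousAt (hKo.mem_nhds hz)
    by_cases h : s z = t z
    · obtain ⟨g, hg, -⟩ := implicit_local P (z, s z) (hsS z hz).1 (hWy _ (hsS z hz).2)
      have h1 : Filter.Tendsto (fun x => (x, s x)) (𝓝 z) (𝓝 (z, s z)) :=
        (continuousAt_id.prodMk hsc)
      have h2 : Filter.Tendsto (fun x => (x, t x)) (𝓝 z) (𝓝 (z, s z)) := by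
        rw [h]; exact (continuousAt_id.prodMk htc)
      filter_upwards [nhdsWithin_le_nhds (h1.eventually hg), nhdsWithin_le_nhds (h2.eventually hg),
        self_mem_nhdsWithin] with w hw1 hw2 hw
      have e1 := hw1.1 (hsS w hw).1
      have e2 := hw2.1 (htS w hw).1
      exact ⟨fun _ => e1.symm.trans e2, fun _ => h⟩
    · have : ∀ᶠ w in 𝓝 z, s w ≠ t w := by
        have h9 : ∀ᶠ w in 𝓝 z, s w - t w ≠ 0 := (hsc.sub htc).eventually_ne (sub_ne_zero.2 h)
        exact h9.mono fun w hw => sub_ne_zero.1 hw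
      filter_upwards [nhdsWithin_le_nhds this] with w hw
      simp [h, hw]

lemma section_local (P : MvPolynomial (Fin 2) ℝ) (W : Set (ℝ × ℝ)) (hW : IsOpen W)
    (hWy : ∀ p ∈ W, evalRR (pderiv 1 P) p ≠ 0) (p : ℝ × ℝ)
    (hp : p ∈ {p | evalRR P p = 0} ∩ W) :
    ∃ (I : Set ℝ) (g : ℝ → ℝ), IsOpen I ∧ IsPreconnected I ∧ ContinuousOn g I ∧
      (∀ x ∈ I, (x, g x) ∈ {p | evalRR P p = 0} ∩ W) ∧ p.1 ∈ I ∧ g p.1 = p.2 ∧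
      HasDerivAt g (-(evalRR (pderiv 0 P) p / evalRR (pderiv 1 P) p)) p.1 ∧
      ∀ᶠ q in 𝓝 p, evalRR P q = 0 → (q.1 ∈ I ∧ g q.1 = q.2) := by
  obtain ⟨g, hg1, hg2, hg3, hg4, hg5⟩ := implicit_local P p hp.1 (hWy p hp.2)
  have hW' : ∀ᶠ x in 𝓝 p.1, (x, g x) ∈ W := by
    have h1 : Filter.Tendsto (fun x => (x, g x)) (𝓝 p.1) (𝓝 p) := by
      have := (continuousAt_id (x := p.1)).prodMk hg5.continuousAt
      have h2 : (p.1, g p.1) = p := by rw [hg3]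
      rw [ContinuousAt, id, h2] at this
      exact this
    exact h1.eventually (hW.mem_nhds hp.2)
  obtain ⟨ε, hε, hb⟩ := Metric.eventually_nhds_iff_ball.1 (hg2.and (hg4.and hW'))
  refine ⟨Metric.ball p.1 ε, g, Metric.isOpen_ball, (convex_ball _ _).isPreconnected,
    fun x hx => (hb x hx).1.continuousWithinAt, fun x hx => (hb x hx).2, Metric.mem_ball_self hε,
    hg3, hg5, ?_⟩
  have h3 : ∀ᶠ q : ℝ × ℝ in 𝓝 p, q.1 ∈ Metric.ball p.1 ε :=
    continuousAt_fst.eventually (Metric.ball_mem_nhds _ hε)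
  filter_upwards [hg1, h3] with q hq1 hq2 hq3
  exact ⟨hq2, hq1.1 hq3⟩

lemma graph_of_component (P : MvPolynomial (Fin 2) ℝ) (W : Set (ℝ × ℝ)) (hW : IsOpen W)
    (hWy : ∀ p ∈ W, evalRR (pderiv 1 P) p ≠ 0) (p₀ : ℝ × ℝ) :
    ∃ (U : Set ℝ) (f : ℝ → ℝ), IsPreconnected U ∧
      (∀ p ∈ connectedComponentIn ({p | evalRR P p = 0} ∩ W) p₀, p.1 ∈ U ∧ f p.1 = p.2) ∧
      (∀ x ∈ U, evalRR P (x, f x) = 0 ∧ (x, f x) ∈ W) ∧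
      (∀ x ∈ U, HasDerivAt f (-(evalRR (pderiv 0 P) (x, f x) / evalRR (pderiv 1 P) (x, f x))) x) := by
  classical
  set S := {p | evalRR P p = 0} ∩ W with hS
  set C := connectedComponentIn S p₀ with hC
  have hCS : C ⊆ S := connectedComponentIn_subset S p₀
  have hCp : IsPreconnected C := isPreconnected_connectedComponentIn
  -- joined by sections
  have join : ∀ p ∈ C, ∀ q ∈ C, SecJoin S p q := by
    intro p hp q hq
    refine hCp.induction₂ (SecJoin S) ?_ ?_ ?_ hp hq
    · intro z hz
      obtain ⟨I, g, h1, h2, h3, h4, h5, h6, -, h7⟩ := section_local P W hW hWy z (hCS hz)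
      filter_upwards [nhdsWithin_le_nhds h7, self_mem_nhdsWithin] with w hw hwC
      have := hw (hCS hwC).1
      exact ⟨I, g, h1, h2, h3, h4, h5, this.1, h6, this.2⟩
    · rintro x y z - - - ⟨I, s, h1, h2, h3, h4, h5, h6, h7, h8⟩ ⟨J, t, k1, k2, k3, k4, k5, k6, k7, k8⟩
      have hIJ : IsPreconnected (I ∩ J) :=
        ((h2.ordConnected).inter k2.ordConnected).isPreconnected
      have agree : ∀ w ∈ I ∩ J, s w = t w := fun w hw =>
        section_unique P W hWy (I ∩ J) hIJ (h1.inter k1) s t (h3.mono Set.inter_subset_left)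
          (k3.mono Set.inter_subset_right) (fun x hx => h4 x hx.1) (fun x hx => k4 x hx.2) y.1 w
          ⟨h6, k5⟩ hw (h8.trans k7.symm)
      set u : ℝ → ℝ := fun w => if w ∈ I then s w else t w with hu
      have uI : ∀ w ∈ I, u w = s w := fun w hw => by simp [hu, hw]
      have uJ : ∀ w ∈ J, u w = t w := fun w hw => by
        by_cases h : w ∈ I
        · rw [uI w h]; exact agree w ⟨h, hw⟩
        · simp [hu, h]
      refine ⟨I ∪ J, u, h1.union k1, h2.union y.1 h6 k5 k2, ?_, ?_, Or.inl h5, Or.inr k6, ?_, ?_⟩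
      · apply ContinuousOn.union_of_isOpen _ _ h1 k1
        · exact h3.congr uI
        · exact k3.congr uJ
      · rintro w (hw | hw)
        · rw [uI w hw]; exact h4 w hw
        · rw [uJ w hw]; exact k4 w hw
      · rw [uI _ h5, h7]
      · rw [uJ _ k6, k8]
    · rintro x y - - ⟨I, s, h1, h2, h3, h4, h5, h6, h7, h8⟩
      exact ⟨I, s, h1, h2, h3, h4, h6, h5, h8, h7⟩
  set U := Prod.fst '' C with hU
  have inj : ∀ p ∈ C, ∀ q ∈ C, p.1 = q.1 → p = q := by
    intro p hp q hq h
    obtain ⟨I, s, h1, h2, h3, h4, h5, h6, h7, h8⟩ := join p hp q hq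
    refine Prod.ext h ?_
    rw [← h7, ← h8, h]
  have hex : ∀ x, ∃ y, x ∈ U → (x, y) ∈ C := by
    intro x
    by_cases hx : x ∈ U
    · obtain ⟨⟨a, b⟩, hp, rfl⟩ := hx
      exact ⟨b, fun _ => hp⟩
    · exact ⟨0, fun h => absurd h hx⟩
  choose f hf using hex
  have hfp : ∀ p ∈ C, p.1 ∈ U ∧ f p.1 = p.2 := by
    intro p hp
    have hpU : p.1 ∈ U := ⟨p, hp, rfl⟩
    refine ⟨hpU, ?_⟩
    have := inj _ (hf p.1 hpU) p hp rfl
    exact congrArg Prod.snd this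
  refine ⟨U, f, hCp.image _ continuous_fst.continuousOn, hfp, fun x hx => hCS (hf x hx), ?_⟩
  intro x hx
  have hxC := hf x hx
  obtain ⟨I, g, h1, h2, h3, h4, h5, h6, h7, -⟩ := section_local P W hW hWy (x, f x) (hCS hxC)
  have hsub : (fun x => (x, g x)) '' I ⊆ C := by
    have hpre : IsPreconnected ((fun x => (x, g x)) '' I) :=
      h2.image _ (continuousOn_id.prodMk h3)
    have hmem : (x, f x) ∈ (fun x => (x, g x)) '' I := ⟨x, h5, by simp only at h6; simp [h6]⟩
    have h8 := hpre.subset_connectedComponentIn hmem (by rintro _ ⟨w, hw, rfl⟩; exact h4 w hw)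
    rwa [← connectedComponentIn_eq hxC] at h8
  refine h7.congr_of_eventuallyEq ?_
  filter_upwards [h1.mem_nhds h5] with w hw
  exact (hfp _ (hsub ⟨w, hw, rfl⟩)).2


/-! ### Part 3: the derivative chain -/

lemma toRF_inj : Function.Injective toRF := IsFractionRing.injective _ _

lemma yx_one (P : MvPolynomial (Fin 2) ℝ) (hy : pderiv 1 P ≠ 0) (Dx : RatFunc2 → RatFunc2)
    (hD : ∀ q : MvPolynomial (Fin 2) ℝ,
          Dx (toRF q) = toRF (pderiv 0 q) -
            (toRF (pderiv 0 P) / toRF (pderiv 1 P)) * toRF (pderiv 1 q))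
    (yx : ℕ → MvPolynomial (Fin 2) ℝ)
    (h : ∀ j : ℕ, 1 ≤ j →
          toRF (yx j) = (toRF (pderiv 1 P)) ^ (2 * j - 1) * Dx^[j] (toRF (X 1))) :
    yx 1 = - pderiv 0 P := by
  have hM : toRF (pderiv 1 P) ≠ 0 := by
    intro h0; exact hy (toRF_inj (by rw [h0, map_zero]))
  apply toRF_inj
  rw [h 1 le_rfl]
  simp only [Function.iterate_one, hD]
  simp [pderiv_X]
  field_simp

lemma Dx_pow (Dx : RatFunc2 → RatFunc2)
    (hmul : ∀ a b, Dx (a * b) = a * Dx b + Dx a * b) (a : RatFunc2) (m : ℕ) :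
    Dx (a ^ (m + 1)) = (m + 1) * a ^ m * Dx a := by
  induction m with
  | zero => simp
  | succ m ih =>
    rw [pow_succ, hmul, ih]
    push_cast
    ring

lemma yx_succ (P : MvPolynomial (Fin 2) ℝ) (hy : pderiv 1 P ≠ 0) (Dx : RatFunc2 → RatFunc2)
    (hmul : ∀ a b, Dx (a * b) = a * Dx b + Dx a * b)
    (hD : ∀ q : MvPolynomial (Fin 2) ℝ,
          Dx (toRF q) = toRF (pderiv 0 q) -
            (toRF (pderiv 0 P) / toRF (pderiv 1 P)) * toRF (pderiv 1 q))
    (yx : ℕ → MvPolynomial (Fin 2) ℝ)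
    (h : ∀ j : ℕ, 1 ≤ j →
          toRF (yx j) = (toRF (pderiv 1 P)) ^ (2 * j - 1) * Dx^[j] (toRF (X 1))) (i : ℕ) :
    yx (i + 2) = pderiv 1 P * (pderiv 1 P * pderiv 0 (yx (i + 1)) - pderiv 0 P * pderiv 1 (yx (i + 1)))
      - (2 * (i : MvPolynomial (Fin 2) ℝ) + 1) * (pderiv 1 P * pderiv 0 (pderiv 1 P) - pderiv 0 P * pderiv 1 (pderiv 1 P))
        * yx (i + 1) := by
  have hM : toRF (pderiv 1 P) ≠ 0 := by
    intro h0; exact hy (toRF_inj (by rw [h0, map_zero]))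
  apply toRF_inj
  have h1 := h (i + 1) (by omega)
  have h2 := h (i + 2) (by omega)
  have e1 : 2 * (i + 1) - 1 = 2 * i + 1 := by omega
  have e2 : 2 * (i + 2) - 1 = 2 * i + 3 := by omega
  rw [e1] at h1
  rw [e2, show i + 2 = (i + 1) + 1 from rfl, Function.iterate_succ_apply'] at h2
  set w := Dx^[i + 1] (toRF (X 1)) with hw
  have h3 := congrArg Dx h1
  rw [hmul, Dx_pow Dx hmul, hD, hD] at h3
  rw [show i + 2 = (i + 1) + 1 from rfl, h2]
  simp only [map_sub, map_mul, map_add, map_natCast, map_ofNat, map_one]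
  set M := toRF (pderiv 1 P)
  set A := toRF (pderiv 0 P)
  push_cast at h3
  have h4 : M ^ (2 * i + 1) * Dx w = toRF (pderiv 0 (yx (i + 1))) - A / M * toRF (pderiv 1 (yx (i + 1)))
      - (2 * (i : RatFunc2) + 1) * M ^ (2 * i) * (toRF (pderiv 0 (pderiv 1 P)) - A / M * toRF (pderiv 1 (pderiv 1 P))) * w := by
    rw [h3]; ring
  have h5 : M ^ (2 * i + 3) * Dx w = M ^ 2 * (M ^ (2 * i + 1) * Dx w) := by ring
  rw [h5, h4, h1]
  field_simp
  ring

lemma chain_deriv (P : MvPolynomial (Fin 2) ℝ) (yx : ℕ → MvPolynomial (Fin 2) ℝ)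
    (h0 : yx 0 = X 1) (h1 : yx 1 = - pderiv 0 P)
    (h2 : ∀ i : ℕ, yx (i + 2) = pderiv 1 P * (pderiv 1 P * pderiv 0 (yx (i + 1)) - pderiv 0 P * pderiv 1 (yx (i + 1)))
      - (2 * (i : MvPolynomial (Fin 2) ℝ) + 1) * (pderiv 1 P * pderiv 0 (pderiv 1 P) - pderiv 0 P * pderiv 1 (pderiv 1 P))
        * yx (i + 1))
    (f : ℝ → ℝ) (x : ℝ) (hM : evalRR (pderiv 1 P) (x, f x) ≠ 0)
    (hf : HasDerivAt f (-(evalRR (pderiv 0 P) (x, f x) / evalRR (pderiv 1 P) (x, f x))) x) (j : ℕ) :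
    HasDerivAt (fun t => evalRR (yx j) (t, f t) / (evalRR (pderiv 1 P) (t, f t)) ^ (2 * j - 1))
      (evalRR (yx (j + 1)) (x, f x) / (evalRR (pderiv 1 P) (x, f x)) ^ (2 * (j + 1) - 1)) x := by
  rcases j with _ | i
  · have e : (fun t => evalRR (yx 0) (t, f t) / (evalRR (pderiv 1 P) (t, f t)) ^ (2 * 0 - 1)) = f := by
      funext t; simp [h0, evalRR]
    rw [e]
    refine hf.congr_deriv ?_
    simp [h1, evalRR, neg_div]
  · have e1 : 2 * (i + 1) - 1 = 2 * i + 1 := by omega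
    have e2 : 2 * (i + 1 + 1) - 1 = 2 * i + 3 := by omega
    rw [e1, e2]
    have d1 := deriv_evalRR (yx (i + 1)) f _ x hf
    have d2 := deriv_evalRR (pderiv 1 P) f _ x hf
    have d3 := d1.div (d2.pow (2 * i + 1)) (pow_ne_zero _ hM)
    refine d3.congr_deriv ?_
    have h3 := congrArg (fun q => evalRR q (x, f x)) (h2 i)
    have hc : evalRR (2 * (i : MvPolynomial (Fin 2) ℝ) + 1) (x, f x) = 2 * (i : ℝ) + 1 := by
      simp [evalRR]
    simp only [evalRR_sub, evalRR_mul, hc] at h3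
    rw [show i + 1 + 1 = i + 2 from rfl, h3]
    simp only [Pi.pow_apply, Nat.add_sub_cancel]
    push_cast
    set M := evalRR (pderiv 1 P) (x, f x)
    field_simp
    ring


/-! ### Part 4: derivative bounds and Taylor expansion -/

lemma sign_const (a b : ℝ) (g : ℝ → ℝ) (hg : ContinuousOn g (Set.Ioo a b))
    (h : (∀ x ∈ Set.Ioo a b, g x = 0) ∨ (∀ x ∈ Set.Ioo a b, g x ≠ 0)) :
    (∀ x ∈ Set.Ioo a b, 0 ≤ g x) ∨ (∀ x ∈ Set.Ioo a b, g x ≤ 0) := by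
  rcases h with h | h
  · left; intro x hx; rw [h x hx]
  · by_contra hcon
    push Not at hcon
    obtain ⟨⟨x, hx, hx'⟩, ⟨y, hy, hy'⟩⟩ := hcon
    obtain ⟨z, hz, hz'⟩ := isPreconnected_Ioo.intermediate_value hx hy hg
      (⟨hx'.le, hy'.le⟩ : (0 : ℝ) ∈ Set.Icc (g x) (g y))
    exact h z hz hz'

lemma abs_sub_le_of_sign {u v C : ℝ} (h : (0 ≤ u ∧ 0 ≤ v) ∨ (u ≤ 0 ∧ v ≤ 0)) (hu : |u| ≤ C)
    (hv : |v| ≤ C) : |u - v| ≤ C := by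
  rw [abs_le] at *
  rcases h with ⟨h1, h2⟩ | ⟨h1, h2⟩ <;> constructor <;> linarith [hu.1, hu.2, hv.1, hv.2]

lemma deriv_bound (a b : ℝ) (F : ℕ → ℝ → ℝ) (r : ℕ)
    (hF : ∀ j, ∀ x ∈ Set.Ioo a b, HasDerivAt (F j) (F (j + 1) x) x)
    (h01 : ∀ x ∈ Set.Ioo a b, 0 ≤ F 0 x ∧ F 0 x ≤ 1)
    (hsign : ∀ j, j ≤ r → (∀ x ∈ Set.Ioo a b, 0 ≤ F j x) ∨ (∀ x ∈ Set.Ioo a b, F j x ≤ 0))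
    (h : ℝ) (hh : 0 < h) (j : ℕ) (hj : j + 1 ≤ r) :
    ∀ x, a < x - j * h → x + j * h < b → |F j x| * h ^ j ≤ 1 := by
  induction j with
  | zero =>
    intro x hx1 hx2
    simp only [Nat.cast_zero, zero_mul, sub_zero, add_zero] at hx1 hx2
    have := h01 x ⟨hx1, hx2⟩
    simp only [pow_zero, mul_one]
    rw [abs_of_nonneg this.1]; exact this.2
  | succ j ih =>
    intro x hx1 hx2
    push_cast at hx1 hx2
    have hjh : 0 ≤ (j : ℝ) * h := by positivity
    have ih' := ih (by omega)
    have hxI : x ∈ Set.Ioo a b := ⟨by nlinarith, by nlinarith⟩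
    have hx := ih' x (by nlinarith) (by nlinarith)
    have hxl := ih' (x - h) (by nlinarith) (by nlinarith)
    have hxr := ih' (x + h) (by nlinarith) (by nlinarith)
    have hIl : x - h ∈ Set.Ioo a b := ⟨by nlinarith, by nlinarith⟩
    have hIr : x + h ∈ Set.Ioo a b := ⟨by nlinarith, by nlinarith⟩
    have hpow : 0 < h ^ j := by positivity
    have conv : ∀ z, |F j z| * h ^ j ≤ 1 → |F j z| ≤ 1 / h ^ j := fun z hz => by
      rwa [le_div_iff₀ hpow]
    have hsj := hsign j (by omega)
    have sgn : ∀ u v, u ∈ Set.Ioo a b → v ∈ Set.Ioo a b →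
        (0 ≤ F j u ∧ 0 ≤ F j v) ∨ (F j u ≤ 0 ∧ F j v ≤ 0) := by
      intro u v hu hv
      rcases hsj with k | k
      · exact Or.inl ⟨k u hu, k v hv⟩
      · exact Or.inr ⟨k u hu, k v hv⟩
    have mono : MonotoneOn (F (j + 1)) (Set.Ioo a b) ∨ AntitoneOn (F (j + 1)) (Set.Ioo a b) := by
      have hc : ContinuousOn (F (j + 1)) (Set.Ioo a b) := fun y hy =>
        (hF (j + 1) y hy).continuousAt.continuousWithinAt
      have hd : DifferentiableOn ℝ (F (j + 1)) (interior (Set.Ioo a b)) := by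
        rw [interior_Ioo]
        exact fun y hy => (hF (j + 1) y hy).differentiableAt.differentiableWithinAt
      rcases hsign (j + 2) (by omega) with k | k
      · left
        refine monotoneOn_of_deriv_nonneg (convex_Ioo a b) hc hd ?_
        rw [interior_Ioo]
        intro y hy; rw [(hF (j + 1) y hy).deriv]; exact k y hy
      · right
        refine antitoneOn_of_deriv_nonpos (convex_Ioo a b) hc hd ?_
        rw [interior_Ioo]
        intro y hy; rw [(hF (j + 1) y hy).deriv]; exact k y hy
    have sub_of : ∀ u v, u ∈ Set.Ioo a b → v ∈ Set.Ioo a b → ∀ y ∈ Set.Icc u v, y ∈ Set.Ioo a b :=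
      fun u v hu hv y hy => ⟨lt_of_lt_of_le hu.1 hy.1, lt_of_le_of_lt hy.2 hv.2⟩
    have finish : ∀ u v, u ∈ Set.Ioo a b → v ∈ Set.Ioo a b → v - u = h →
        |F j u| * h ^ j ≤ 1 → |F j v| * h ^ j ≤ 1 →
        (∀ ξ ∈ Set.Icc u v, |F (j + 1) x| ≤ |F (j + 1) ξ|) → |F (j + 1) x| * h ^ (j + 1) ≤ 1 := by
      intro u v hu hv huv h1 h2 h3
      have hlt : u < v := by linarith
      obtain ⟨ξ, hξ, e⟩ := exists_hasDerivAt_eq_slope (F j) (F (j + 1)) hlt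
        (fun y hy => (hF j y (sub_of u v hu hv y hy)).continuousAt.continuousWithinAt)
        (fun y hy => hF j y (sub_of u v hu hv y ⟨hy.1.le, hy.2.le⟩))
      have h4 := h3 ξ ⟨hξ.1.le, hξ.2.le⟩
      have h5 := abs_sub_le_of_sign (sgn v u hv hu) (conv v h2) (conv u h1)
      rw [huv] at e
      have h6 : |F (j + 1) ξ| * h = |F j v - F j u| := by
        rw [e, abs_div, abs_of_pos hh]; field_simp
      have h7 : |F (j + 1) x| * h ≤ 1 / h ^ j := by
        calc _ ≤ |F (j + 1) ξ| * h := by gcongr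
          _ ≤ _ := by rw [h6]; exact h5
      rw [le_div_iff₀ hpow] at h7
      calc _ = |F (j + 1) x| * h * h ^ j := by ring
        _ ≤ 1 := h7
    rcases hsign (j + 1) (by omega) with k | k <;> rcases mono with m | m
    · refine finish x (x + h) hxI hIr (by ring) hx hxr ?_
      intro ξ hξ
      have hξI := sub_of _ _ hxI hIr ξ hξ
      rw [abs_of_nonneg (k x hxI), abs_of_nonneg (k ξ hξI)]
      exact m hxI hξI hξ.1
    · refine finish (x - h) x hIl hxI (by ring) hxl hx ?_
      intro ξ hξ
      have hξI := sub_of _ _ hIl hxI ξ hξ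
      rw [abs_of_nonneg (k x hxI), abs_of_nonneg (k ξ hξI)]
      exact m hξI hxI hξ.2
    · refine finish (x - h) x hIl hxI (by ring) hxl hx ?_
      intro ξ hξ
      have hξI := sub_of _ _ hIl hxI ξ hξ
      rw [abs_of_nonpos (k x hxI), abs_of_nonpos (k ξ hξI)]
      exact neg_le_neg (m hξI hxI hξ.2)
    · refine finish x (x + h) hxI hIr (by ring) hx hxr ?_
      intro ξ hξ
      have hξI := sub_of _ _ hxI hIr ξ hξ
      rw [abs_of_nonpos (k x hxI), abs_of_nonpos (k ξ hξI)]
      exact neg_le_neg (m hxI hξI hξ.1)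

lemma self_pow_le (j : ℕ) : (j : ℝ) ^ j ≤ 3 ^ j * (j.factorial : ℝ) := by
  have h1 := Real.pow_div_factorial_le_exp (x := (j : ℝ)) (by positivity) j
  have hf : (0 : ℝ) < j.factorial := by positivity
  rw [div_le_iff₀ hf] at h1
  have h2 : Real.exp j ≤ 3 ^ j := by
    rw [← Real.exp_one_pow]
    have := Real.exp_one_lt_d9
    gcongr
    linarith
  calc _ ≤ Real.exp j * j.factorial := h1
    _ ≤ _ := by gcongr

lemma deriv_bound' (a b : ℝ) (F : ℕ → ℝ → ℝ) (r : ℕ)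
    (hF : ∀ j, ∀ x ∈ Set.Ioo a b, HasDerivAt (F j) (F (j + 1) x) x)
    (h01 : ∀ x ∈ Set.Ioo a b, 0 ≤ F 0 x ∧ F 0 x ≤ 1)
    (hsign : ∀ j, j ≤ r → (∀ x ∈ Set.Ioo a b, 0 ≤ F j x) ∨ (∀ x ∈ Set.Ioo a b, F j x ≤ 0))
    (x0 ρ : ℝ) (hρ : 0 < ρ) (ha : a ≤ x0 - ρ) (hb : x0 + ρ ≤ b) (j : ℕ) (hj : j + 1 ≤ r)
    (ξ : ℝ) (hξ : |ξ - x0| ≤ ρ / 2) : |F j ξ| ≤ j.factorial * (12 / ρ) ^ j := by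
  rw [abs_le] at hξ
  rcases Nat.eq_zero_or_pos j with rfl | hj0
  · have := h01 ξ ⟨by linarith [hξ.1], by linarith [hξ.2]⟩
    simp only [Nat.factorial_zero, Nat.cast_one, pow_zero, mul_one]
    rw [abs_of_nonneg this.1]; exact this.2
  · have hj1 : (0 : ℝ) < j := by exact_mod_cast hj0
    have e : (j : ℝ) * (ρ / (4 * j)) = ρ / 4 := by field_simp
    have := deriv_bound a b F r hF h01 hsign (ρ / (4 * j)) (by positivity) j hj ξ
      (by rw [e]; linarith [hξ.1]) (by rw [e]; linarith [hξ.2])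
    have h1 : (0 : ℝ) < (ρ / (4 * j)) ^ j := by positivity
    rw [← le_div_iff₀ h1] at this
    refine this.trans ?_
    have h2 := self_pow_le j
    have h3 : 1 / (ρ / (4 * (j : ℝ))) ^ j = (j : ℝ) ^ j * (4 / ρ) ^ j := by
      rw [← mul_pow, ← one_div_pow]; congr 1; field_simp
    rw [h3]
    calc _ ≤ (3 ^ j * (j.factorial : ℝ)) * (4 / ρ) ^ j := by gcongr
      _ = j.factorial * (12 / ρ) ^ j := by
        rw [show (12 : ℝ) / ρ = 3 * (4 / ρ) by ring, mul_pow]; ring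

lemma taylor_deriv (F : ℕ → ℝ → ℝ) (x s : ℝ) (hF : ∀ j, HasDerivAt (F j) (F (j + 1) s) s) (n : ℕ) :
    HasDerivAt (fun s => ∑ j ∈ Finset.range (n + 1), F j s / j.factorial * (x - s) ^ j)
      (F (n + 1) s / n.factorial * (x - s) ^ n) s := by
  induction n with
  | zero => simpa using hF 0
  | succ n ih =>
    have e : (fun s => ∑ j ∈ Finset.range (n + 1 + 1), F j s / j.factorial * (x - s) ^ j) =
        fun s => (∑ j ∈ Finset.range (n + 1), F j s / j.factorial * (x - s) ^ j) +
          F (n + 1) s / (n + 1).factorial * (x - s) ^ (n + 1) := by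
      funext s; rw [Finset.sum_range_succ]
    rw [e]
    have h1 : HasDerivAt (fun s => (x - s) ^ (n + 1)) (((n + 1 : ℕ) : ℝ) * (x - s) ^ n * (-1)) s := by
      have := ((hasDerivAt_id s).const_sub x).pow (n + 1)
      refine this.congr_deriv ?_
      simp
    have h2 := ih.add (((hF (n + 1)).div_const ((n + 1).factorial : ℝ)).mul h1)
    refine h2.congr_deriv ?_
    rw [Nat.factorial_succ]
    push_cast
    have : (n.factorial : ℝ) ≠ 0 := by positivity
    field_simp
    ring

lemma taylor_bound (a b : ℝ) (F : ℕ → ℝ → ℝ) (r : ℕ)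
    (hF : ∀ j, ∀ x ∈ Set.Ioo a b, HasDerivAt (F j) (F (j + 1) x) x)
    (h01 : ∀ x ∈ Set.Ioo a b, 0 ≤ F 0 x ∧ F 0 x ≤ 1)
    (hsign : ∀ j, j ≤ r → (∀ x ∈ Set.Ioo a b, 0 ≤ F j x) ∨ (∀ x ∈ Set.Ioo a b, F j x ≤ 0))
    (x0 ρ : ℝ) (hρ : 0 < ρ) (ha : a ≤ x0 - ρ) (hb : x0 + ρ ≤ b) (n : ℕ) (hn : 1 ≤ n) (hj : n + 1 ≤ r)
    (x : ℝ) (hx : |x - x0| ≤ ρ / 2) :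
    |F 0 x - ∑ j ∈ Finset.range n, F j x0 / j.factorial * (x - x0) ^ j| ≤
      n * (12 / ρ) ^ n * |x - x0| ^ n := by
  obtain ⟨m, rfl⟩ : ∃ m, n = m + 1 := ⟨n - 1, by omega⟩
  set φ := fun s => ∑ j ∈ Finset.range (m + 1), F j s / j.factorial * (x - s) ^ j with hφ
  have hseg : ∀ s ∈ Set.uIcc x0 x, |s - x0| ≤ ρ / 2 ∧ |x - s| ≤ |x - x0| := by
    intro s hs
    have h1 := Set.abs_sub_left_of_mem_uIcc hs
    have h2 := Set.abs_sub_right_of_mem_uIcc hs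
    exact ⟨h1.trans hx, h2⟩
  have hI : ∀ s ∈ Set.uIcc x0 x, s ∈ Set.Ioo a b := by
    intro s hs
    have := (abs_le.1 (hseg s hs).1)
    exact ⟨by linarith [this.1], by linarith [this.2]⟩
  have key := (convex_uIcc x0 x).norm_image_sub_le_of_norm_hasDerivWithin_le
    (f := φ) (f' := fun s => F (m + 1) s / m.factorial * (x - s) ^ m)
    (C := ((m + 1 : ℕ) : ℝ) * (12 / ρ) ^ (m + 1) * |x - x0| ^ m)
    (fun s hs => (taylor_deriv F x s (fun j => hF j s (hI s hs)) m).hasDerivWithinAt) ?_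
    Set.left_mem_uIcc Set.right_mem_uIcc
  · have e : φ x = F 0 x := by
      simp only [hφ, sub_self]
      rw [Finset.sum_range_succ']
      simp
    rw [e] at key
    simp only [Real.norm_eq_abs] at key
    refine key.trans (le_of_eq ?_)
    ring
  · intro s hs
    have h1 := deriv_bound' a b F r hF h01 hsign x0 ρ hρ ha hb (m + 1) hj s (hseg s hs).1
    rw [Real.norm_eq_abs, abs_mul, abs_div, abs_pow]
    have hf : (0 : ℝ) < m.factorial := by positivity
    rw [abs_of_pos hf]
    have h2 : |F (m + 1) s| / m.factorial ≤ ((m + 1 : ℕ) : ℝ) * (12 / ρ) ^ (m + 1) := by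
      rw [div_le_iff₀ hf]
      refine h1.trans (le_of_eq ?_)
      rw [Nat.factorial_succ]; push_cast; ring
    have h3 := (hseg s hs).2
    gcongr

/-! ### Part 5: pigeonhole -/

lemma pigeon_lemma {ι : Type} [Fintype ι] [DecidableEq ι] (D n B : ℕ) (hD : Fintype.card ι = D)
    (h2n : 2 * n ≤ D) (hn : 1 ≤ n) (hB : 1 ≤ B) (A η : ℝ) (hA : 0 < A) (hη : 0 < η)
    (hBη : 2 * D * A ≤ B * η)
    (c : ι → ℕ → ℝ) (hc : ∀ i j, |c i j| ≤ A) :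
    ∃ a : ι → ℤ, a ≠ 0 ∧ (∀ i, |(a i : ℝ)| ≤ B) ∧
      ∀ j, j < n → |∑ i, (a i : ℝ) * c i j| ≤ η := by
  have hBr : (0 : ℝ) < B := by exact_mod_cast hB
  -- the linear forms, shifted
  let s : (ι → Fin (B + 1)) → ℕ → ℝ := fun v j => ∑ i, (((v i : ℕ) : ℝ)) * c i j
  have hs : ∀ v j, |s v j| ≤ D * B * A := by
    intro v j
    calc |s v j| ≤ ∑ i, |(((v i : ℕ) : ℝ)) * c i j| := Finset.abs_sum_le_sum_abs _ _
      _ ≤ ∑ i : ι, (B : ℝ) * A := by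
        refine Finset.sum_le_sum fun i _ => ?_
        rw [abs_mul]
        have h1 : |((v i : ℕ) : ℝ)| ≤ B := by
          rw [Nat.abs_cast]
          have := (v i).is_lt
          exact_mod_cast Nat.lt_succ_iff.1 this
        have := hc i j
        gcongr
      _ = D * B * A := by
        rw [Finset.sum_const, Finset.card_univ, hD, nsmul_eq_mul]; ring
  let g : (ι → Fin (B + 1)) → (Fin n → Fin (B ^ 2 + 1)) := fun v j =>
    ⟨⌊(s v j + D * B * A) / η⌋₊, by
      have h1 := (abs_le.1 (hs v j)).2
      have h2 : (s v j + D * B * A) / η ≤ ((B ^ 2 : ℕ) : ℝ) := by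
        rw [div_le_iff₀ hη]
        push_cast
        nlinarith
      have := Nat.floor_le_floor h2
      rw [Nat.floor_natCast] at this
      omega⟩
  have hcard : Fintype.card (Fin n → Fin (B ^ 2 + 1)) < Fintype.card (ι → Fin (B + 1)) := by
    simp only [Fintype.card_pi, Fintype.card_fin, Finset.prod_const, Finset.card_univ, hD]
    calc (B ^ 2 + 1) ^ n < ((B + 1) ^ 2) ^ n := by
          refine Nat.pow_lt_pow_left ?_ (by omega)
          nlinarith
      _ = (B + 1) ^ (2 * n) := by rw [← pow_mul]
      _ ≤ (B + 1) ^ D := Nat.pow_le_pow_right (by omega) h2n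
  obtain ⟨v, w, hvw, hg⟩ := Fintype.exists_ne_map_eq_of_card_lt g hcard
  refine ⟨fun i => ((v i : ℕ) : ℤ) - ((w i : ℕ) : ℤ), ?_, ?_, ?_⟩
  · intro h
    apply hvw
    funext i
    have := congrFun h i
    simp only [Pi.zero_apply] at this
    apply Fin.ext
    omega
  · intro i
    have h1 := (v i).is_lt
    have h2 := (w i).is_lt
    have h3 : |((v i : ℕ) : ℤ) - ((w i : ℕ) : ℤ)| ≤ (B : ℤ) := by
      rw [abs_le]; constructor <;> omega
    exact_mod_cast h3
  · intro j hj
    have h1 : ⌊(s v j + D * B * A) / η⌋₊ = ⌊(s w j + D * B * A) / η⌋₊ := by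
      have := congrArg Fin.val (congrFun hg ⟨j, hj⟩)
      simpa [g] using this
    have h2 : ∑ i, (((((v i : ℕ) : ℤ) - ((w i : ℕ) : ℤ) : ℤ)) : ℝ) * c i j = s v j - s w j := by
      simp only [s, ← Finset.sum_sub_distrib]
      refine Finset.sum_congr rfl fun i _ => ?_
      push_cast; ring
    rw [h2]
    have nn : ∀ v, 0 ≤ (s v j + D * B * A) / η := fun v => by
      have := (abs_le.1 (hs v j)).1
      exact div_nonneg (by linarith) hη.le
    have a1 := Nat.floor_le (nn v)
    have a2 := Nat.lt_floor_add_one ((s v j + D * B * A) / η)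
    have b1 := Nat.floor_le (nn w)
    have b2 := Nat.lt_floor_add_one ((s w j + D * B * A) / η)
    rw [h1] at a1 a2
    rw [le_div_iff₀ hη] at a1 b1
    rw [div_lt_iff₀ hη] at a2 b2
    rw [abs_le]
    constructor <;> nlinarith

/-! ### Dominance of polynomials -/

def PDom (p q : Polynomial ℝ) : Prop := ∀ i, |p.coeff i| ≤ q.coeff i

lemma PDom.nonneg {p q : Polynomial ℝ} (h : PDom p q) (i : ℕ) : 0 ≤ q.coeff i :=
  (abs_nonneg _).trans (h i)

lemma PDom.one : PDom 1 1 := by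
  intro i
  rw [Polynomial.coeff_one]
  split_ifs <;> simp

lemma PDom.mul {p q p' q' : Polynomial ℝ} (h : PDom p q) (h' : PDom p' q') :
    PDom (p * p') (q * q') := by
  intro i
  rw [Polynomial.coeff_mul, Polynomial.coeff_mul]
  refine (Finset.abs_sum_le_sum_abs _ _).trans (Finset.sum_le_sum fun x _ => ?_)
  rw [abs_mul]
  exact mul_le_mul (h _) (h' _) (abs_nonneg _) (h.nonneg _)

lemma PDom.pow {p q : Polynomial ℝ} (h : PDom p q) (n : ℕ) : PDom (p ^ n) (q ^ n) := by
  induction n with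
  | zero => simpa using PDom.one
  | succ n ih => rw [pow_succ, pow_succ]; exact ih.mul h

lemma PDom.coeff_le {p q : Polynomial ℝ} (h : PDom p q) (i : ℕ) : |p.coeff i| ≤ q.eval 1 := by
  refine (h i).trans ?_
  rw [Polynomial.eval_eq_sum_range]
  simp only [one_pow, mul_one]
  by_cases hi : i ≤ q.natDegree
  · exact Finset.single_le_sum (f := fun i => q.coeff i) (fun j _ => h.nonneg j)
      (Finset.mem_range.2 (by omega))
  · rw [Polynomial.coeff_eq_zero_of_natDegree_lt (by omega)]
    exact Finset.sum_nonneg fun j _ => h.nonneg j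

lemma PDom.tail {p q : Polynomial ℝ} (h : PDom p q) (n : ℕ) (t : ℝ) (ht : |t| ≤ 1) :
    |p.eval t - ∑ j ∈ Finset.range n, p.coeff j * t ^ j| ≤ |t| ^ n * q.eval 1 := by
  set N := max (max p.natDegree q.natDegree + 1) n with hN
  have e1 : p.eval t = ∑ j ∈ Finset.range N, p.coeff j * t ^ j :=
    Polynomial.eval_eq_sum_range' (by omega) t
  have e2 : q.eval 1 = ∑ j ∈ Finset.range N, q.coeff j * 1 ^ j :=
    Polynomial.eval_eq_sum_range' (by omega) 1
  rw [e1, e2, ← Finset.sum_range_add_sum_Ico _ (show n ≤ N by omega),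
    add_sub_cancel_left]
  refine (Finset.abs_sum_le_sum_abs _ _).trans ?_
  calc ∑ i ∈ Finset.Ico n N, |p.coeff i * t ^ i|
      ≤ ∑ i ∈ Finset.Ico n N, |t| ^ n * (q.coeff i * 1 ^ i) := by
        refine Finset.sum_le_sum fun i hi => ?_
        rw [Finset.mem_Ico] at hi
        rw [abs_mul, abs_pow, one_pow, mul_one, mul_comm]
        have := h i
        have h2 := pow_le_pow_of_le_one (abs_nonneg t) ht hi.1
        exact mul_le_mul h2 this (abs_nonneg _) (by positivity)
    _ ≤ ∑ i ∈ Finset.range N, |t| ^ n * (q.coeff i * 1 ^ i) := by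
        refine Finset.sum_le_sum_of_subset_of_nonneg ?_ ?_
        · intro i hi; rw [Finset.mem_Ico] at hi; exact Finset.mem_range.2 hi.2
        · intro i _ _
          have := h.nonneg i
          positivity
    _ = _ := by rw [← Finset.mul_sum, ← Finset.sum_range_add_sum_Ico _ (show n ≤ N by omega)]

lemma pow_sub_pow_le (u v : ℝ) (hu : |u| ≤ 2) (hv : |v| ≤ 2) (β : ℕ) :
    |u ^ β - v ^ β| ≤ β * 2 ^ β * |u - v| := by
  induction β with
  | zero => simp
  | succ β ih =>
    have e : u ^ (β + 1) - v ^ (β + 1) = u * (u ^ β - v ^ β) + v ^ β * (u - v) := by ring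
    rw [e]
    refine (abs_add_le _ _).trans ?_
    rw [abs_mul, abs_mul, abs_pow]
    have h1 : |v| ^ β ≤ 2 ^ β := by gcongr
    have h2 : |u| * |u ^ β - v ^ β| ≤ 2 * (β * 2 ^ β * |u - v|) := by gcongr
    have h3 : |v| ^ β * |u - v| ≤ 2 ^ β * |u - v| := by gcongr
    have h4 : 0 ≤ 2 ^ β * |u - v| := by positivity
    push_cast
    rw [pow_succ]
    nlinarith

/-! ### Part 6: local interpolation -/

lemma approx_lemma (a b : ℝ) (F : ℕ → ℝ → ℝ) (r : ℕ)
    (hF : ∀ j, ∀ x ∈ Set.Ioo a b, HasDerivAt (F j) (F (j + 1) x) x)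
    (h01 : ∀ x ∈ Set.Ioo a b, 0 ≤ F 0 x ∧ F 0 x ≤ 1)
    (hsign : ∀ j, j ≤ r → (∀ x ∈ Set.Ioo a b, 0 ≤ F j x) ∨ (∀ x ∈ Set.Ioo a b, F j x ≤ 0))
    (ha0 : 0 ≤ a) (hb1 : b ≤ 1)
    (x0 ρ : ℝ) (hρ : 0 < ρ) (ha : a ≤ x0 - ρ) (hb : x0 + ρ ≤ b) (n : ℕ) (hn : 1 ≤ n)
    (hj : n + 1 ≤ r) (m : ℕ) :
    ∃ c : Fin (m + 1) × Fin (m + 1) → ℕ → ℝ, (∀ i j, |c i j| ≤ 4 ^ m) ∧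
      ∀ x ∈ Set.Ioo a b, ∀ t, t = 24 * (x - x0) / ρ → |t| ≤ 1 → ∀ i,
        |x ^ (i.1 : ℕ) * F 0 x ^ (i.2 : ℕ) - ∑ j ∈ Finset.range n, c i j * t ^ j| ≤
          2 * 4 ^ m * |t| ^ n := by
  let p : Polynomial ℝ := ∑ j ∈ Finset.range n,
    Polynomial.monomial j (F j x0 / j.factorial * (ρ / 24) ^ j)
  let p' : Polynomial ℝ := ∑ j ∈ Finset.range n, Polynomial.monomial j ((1 / 2 : ℝ) ^ j)
  let l : Polynomial ℝ := Polynomial.C x0 + Polynomial.C (ρ / 24) * Polynomial.X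
  let l' : Polynomial ℝ := 1 + Polynomial.X
  have hp : PDom p p' := by
    intro i
    simp only [p, p', Polynomial.finsetSum_coeff, Polynomial.coeff_monomial, Finset.sum_ite_eq',
      Finset.mem_range]
    split_ifs with h
    · have h1 := deriv_bound' a b F r hF h01 hsign x0 ρ hρ ha hb i (by omega) x0
        (by simp; positivity)
      have hf : (0 : ℝ) < i.factorial := by positivity
      rw [abs_mul, abs_div, abs_of_pos hf, abs_of_pos (show 0 < (ρ / 24) ^ i by positivity)]
      calc |F i x0| / i.factorial * (ρ / 24) ^ i ≤
          (i.factorial * (12 / ρ) ^ i) / i.factorial * (ρ / 24) ^ i := by gcongr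
        _ = (12 / ρ) ^ i * (ρ / 24) ^ i := by field_simp
        _ = (1 / 2) ^ i := by rw [← mul_pow]; congr 1; field_simp; norm_num
    · simp
  have hl : PDom l l' := by
    intro i
    have hx1 : |x0| ≤ 1 := by rw [abs_le]; constructor <;> linarith
    have hr1 : |ρ / 24| ≤ 1 := by rw [abs_of_pos (by positivity)]; linarith
    rcases i with _ | _ | i
    · simpa [l, l', Polynomial.coeff_one] using hx1
    · simpa [l, l', Polynomial.coeff_one, Polynomial.coeff_C] using hr1
    · simp [l, l', Polynomial.coeff_one, Polynomial.coeff_C, Polynomial.coeff_X]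
  have hp2 : p'.eval 1 ≤ 2 := by
    simp only [p', Polynomial.eval_finsetSum, Polynomial.eval_monomial, one_pow, mul_one]
    have := sum_geometric_two_le n
    simpa using this
  have hp0 : 0 ≤ p'.eval 1 := (abs_nonneg _).trans (hp.coeff_le 0)
  have hl2 : l'.eval 1 = 2 := by simp [l']; norm_num
  have hR : ∀ i : Fin (m + 1) × Fin (m + 1),
      (l' ^ (i.1 : ℕ) * p' ^ (i.2 : ℕ)).eval 1 ≤ 4 ^ m := by
    intro i
    rw [Polynomial.eval_mul, Polynomial.eval_pow, Polynomial.eval_pow, hl2]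
    have h1 : (i.1 : ℕ) ≤ m := by omega
    have h2 : (i.2 : ℕ) ≤ m := by omega
    calc (2 : ℝ) ^ (i.1 : ℕ) * p'.eval 1 ^ (i.2 : ℕ) ≤ 2 ^ m * 2 ^ m := by
          have a1 : (2 : ℝ) ^ (i.1 : ℕ) ≤ 2 ^ m := pow_le_pow_right₀ (by norm_num) h1
          have a2 : (2 : ℝ) ^ (i.2 : ℕ) ≤ 2 ^ m := pow_le_pow_right₀ (by norm_num) h2
          have a3 : p'.eval 1 ^ (i.2 : ℕ) ≤ 2 ^ (i.2 : ℕ) := by gcongr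
          exact mul_le_mul a1 (a3.trans a2) (by positivity) (by positivity)
      _ = 4 ^ m := by rw [← mul_pow]; norm_num
  refine ⟨fun i j => (l ^ (i.1 : ℕ) * p ^ (i.2 : ℕ)).coeff j, ?_, ?_⟩
  · intro i j
    exact (((hl.pow _).mul (hp.pow _)).coeff_le j).trans (hR i)
  · intro x hx t ht ht1 i
    have hxt : x - x0 = t * (ρ / 24) := by rw [ht]; field_simp
    have hxx : |x - x0| = |t| * (ρ / 24) := by
      rw [hxt, abs_mul, abs_of_pos (show 0 < ρ / 24 by positivity)]
    have hle : l.eval t = x := by simp [l]; linarith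
    have hpe : p.eval t = ∑ j ∈ Finset.range n, F j x0 / j.factorial * (x - x0) ^ j := by
      simp only [p, Polynomial.eval_finsetSum, Polynomial.eval_monomial]
      refine Finset.sum_congr rfl fun j _ => ?_
      rw [hxt, mul_pow]; ring
    have hT := taylor_bound a b F r hF h01 hsign x0 ρ hρ ha hb n hn hj x
      (by rw [hxx]; nlinarith [abs_nonneg t])
    rw [← hpe, hxx] at hT
    have hT' : |F 0 x - p.eval t| ≤ |t| ^ n := by
      refine hT.trans ?_
      have e : (n : ℝ) * (12 / ρ) ^ n * (|t| * (ρ / 24)) ^ n = n * (1 / 2) ^ n * |t| ^ n := by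
        rw [mul_assoc, ← mul_pow, mul_assoc, ← mul_pow]; congr 2; field_simp; ring
      rw [e]
      have h2 : (n : ℝ) * (1 / 2) ^ n ≤ 1 := by
        have : (n : ℝ) ≤ 2 ^ n := by exact_mod_cast (Nat.lt_two_pow_self (n := n)).le
        rw [one_div, inv_pow, ← div_eq_mul_inv, div_le_one (by positivity)]
        exact this
      have : 0 ≤ |t| ^ n := by positivity
      nlinarith
    have hf2 : |F 0 x| ≤ 2 := by
      have := h01 x hx
      rw [abs_of_nonneg this.1]; linarith [this.2]
    have hpv : |p.eval t| ≤ 2 := by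
      have := hp.tail 0 t ht1
      simp only [Finset.range_zero, Finset.sum_empty, sub_zero, pow_zero, one_mul] at this
      exact this.trans hp2
    have hd := pow_sub_pow_le (F 0 x) (p.eval t) hf2 hpv (i.2 : ℕ)
    have htail := ((hl.pow (i.1 : ℕ)).mul (hp.pow (i.2 : ℕ))).tail n t ht1
    rw [Polynomial.eval_mul, Polynomial.eval_pow, Polynomial.eval_pow, hle] at htail
    have hR' := hR i
    have htn : 0 ≤ |t| ^ n := by positivity
    have h1 : (i.2 : ℕ) ≤ m := by omega
    have hb2 : ((i.2 : ℕ) : ℝ) * 2 ^ (i.2 : ℕ) ≤ 4 ^ m := by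
      have b1 : ((i.2 : ℕ) : ℝ) ≤ 2 ^ m := by
        have := (Nat.lt_two_pow_self (n := m)).le
        exact_mod_cast h1.trans this
      have b2 : (2 : ℝ) ^ (i.2 : ℕ) ≤ 2 ^ m := pow_le_pow_right₀ (by norm_num) h1
      calc _ ≤ (2 : ℝ) ^ m * 2 ^ m := mul_le_mul b1 b2 (by positivity) (by positivity)
        _ = 4 ^ m := by rw [← mul_pow]; norm_num
    have hxa : |x ^ (i.1 : ℕ)| ≤ 1 := by
      rw [abs_pow]
      refine pow_le_one₀ (abs_nonneg _) ?_
      rw [abs_le]; constructor <;> linarith [hx.1, hx.2]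
    have e : x ^ (i.1 : ℕ) * F 0 x ^ (i.2 : ℕ) - ∑ j ∈ Finset.range n,
        (l ^ (i.1 : ℕ) * p ^ (i.2 : ℕ)).coeff j * t ^ j =
        x ^ (i.1 : ℕ) * (F 0 x ^ (i.2 : ℕ) - p.eval t ^ (i.2 : ℕ)) +
        (x ^ (i.1 : ℕ) * p.eval t ^ (i.2 : ℕ) - ∑ j ∈ Finset.range n,
        (l ^ (i.1 : ℕ) * p ^ (i.2 : ℕ)).coeff j * t ^ j) := by ring
    rw [e]
    refine (abs_add_le _ _).trans ?_
    rw [abs_mul]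
    have z1 : |x ^ (i.1 : ℕ)| * |F 0 x ^ (i.2 : ℕ) - p.eval t ^ (i.2 : ℕ)| ≤ 4 ^ m * |t| ^ n := by
      calc _ ≤ 1 * |F 0 x ^ (i.2 : ℕ) - p.eval t ^ (i.2 : ℕ)| := by gcongr
        _ ≤ ((i.2 : ℕ) : ℝ) * 2 ^ (i.2 : ℕ) * |F 0 x - p.eval t| := by rw [one_mul]; exact hd
        _ ≤ 4 ^ m * |t| ^ n := by gcongr
    have z2 : |t| ^ n * (l' ^ (i.1 : ℕ) * p' ^ (i.2 : ℕ)).eval 1 ≤ |t| ^ n * 4 ^ m := by gcongr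
    have := htail.trans z2
    linarith

/-- The bihomogeneous polynomial with given integer coefficients. -/
noncomputable def bipoly (m : ℕ) (a : Fin (m + 1) × Fin (m + 1) → ℤ) : MvPolynomial (Fin 2) ℝ :=
  ∑ i, monomial (Finsupp.single 0 (i.1 : ℕ) + Finsupp.single 1 (i.2 : ℕ)) (a i : ℝ)

lemma bipoly_exp_inj (m : ℕ) (i i' : Fin (m + 1) × Fin (m + 1))
    (h : (Finsupp.single (0 : Fin 2) (i.1 : ℕ) + Finsupp.single 1 (i.2 : ℕ)) =
      Finsupp.single (0 : Fin 2) (i'.1 : ℕ) + Finsupp.single 1 (i'.2 : ℕ)) : i = i' := by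
  have h0 := DFunLike.congr_fun h 0
  have h1 := DFunLike.congr_fun h 1
  simp at h0 h1
  exact Prod.ext (Fin.ext h0) (Fin.ext h1)

lemma bipoly_ne_zero (m : ℕ) (a : Fin (m + 1) × Fin (m + 1) → ℤ) (ha : a ≠ 0) :
    bipoly m a ≠ 0 := by
  intro h
  apply ha
  funext i
  have := congrArg (coeff (Finsupp.single 0 (i.1 : ℕ) + Finsupp.single 1 (i.2 : ℕ))) h
  rw [bipoly, coeff_sum, Finset.sum_eq_single i] at this
  · simpa using this
  · intro j _ hj
    rw [coeff_monomial, if_neg]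
    exact fun h => hj (bipoly_exp_inj m j i h)
  · simp

lemma bipoly_deg (m : ℕ) (a : Fin (m + 1) × Fin (m + 1) → ℤ) :
    (bipoly m a).totalDegree ≤ 2 * m := by
  refine totalDegree_finsetSum_le fun i _ => ?_
  refine (totalDegree_monomial_le _ _).trans ?_
  have h1 := i.1.is_lt
  have h2 := i.2.is_lt
  rw [Finsupp.sum_add_index' (by simp) (by intros; rfl), Finsupp.sum_single_index rfl,
    Finsupp.sum_single_index rfl]
  simp only [id]
  omega

lemma bipoly_eval (m : ℕ) (a : Fin (m + 1) × Fin (m + 1) → ℤ) (x y : ℝ) :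
    evalRR (bipoly m a) (x, y) = ∑ i, (a i : ℝ) * (x ^ (i.1 : ℕ) * y ^ (i.2 : ℕ)) := by
  rw [evalRR, bipoly, map_sum]
  refine Finset.sum_congr rfl fun i _ => ?_
  rw [eval_monomial, Finsupp.prod_add_index' (by simp) (by intros; rw [pow_add])]
  simp

lemma bipoly_int (m : ℕ) (a : Fin (m + 1) × Fin (m + 1) → ℤ) (q₁ q₂ : ℚ) (H : ℝ)
    (h1 : (ratHeight q₁ : ℝ) ≤ H) (h2 : (ratHeight q₂ : ℝ) ≤ H) (hH : 1 ≤ H)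
    (hlt : |evalRR (bipoly m a) ((q₁ : ℝ), (q₂ : ℝ))| < 1 / H ^ (2 * m)) :
    evalRR (bipoly m a) ((q₁ : ℝ), (q₂ : ℝ)) = 0 := by
  have d1 : (q₁.den : ℝ) ≤ H := le_trans (by exact_mod_cast le_max_right _ _) h1
  have d2 : (q₂.den : ℝ) ≤ H := le_trans (by exact_mod_cast le_max_right _ _) h2
  have p1 : (0 : ℝ) < q₁.den := by exact_mod_cast q₁.den_pos
  have p2 : (0 : ℝ) < q₂.den := by exact_mod_cast q₂.den_pos
  have key : ∀ (q : ℚ) (j : ℕ), j ≤ m → (q : ℝ) ^ j * (q.den : ℝ) ^ m =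
      ((q.num ^ j * (q.den : ℤ) ^ (m - j) : ℤ) : ℝ) := by
    intro q j hj
    have hq : (q : ℝ) * q.den = q.num := by exact_mod_cast Rat.mul_den_eq_num q
    push_cast
    rw [← hq, mul_pow, mul_assoc, ← pow_add, Nat.add_sub_cancel' hj]
  have : ∃ z : ℤ, evalRR (bipoly m a) ((q₁ : ℝ), (q₂ : ℝ)) *
      ((q₁.den : ℝ) ^ m * (q₂.den : ℝ) ^ m) = z := by
    refine ⟨∑ i : Fin (m + 1) × Fin (m + 1), a i * ((q₁.num ^ (i.1 : ℕ) * (q₁.den : ℤ) ^ (m - (i.1 : ℕ))) *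
      (q₂.num ^ (i.2 : ℕ) * (q₂.den : ℤ) ^ (m - (i.2 : ℕ)))), ?_⟩
    rw [bipoly_eval, Finset.sum_mul, Int.cast_sum]
    refine Finset.sum_congr rfl fun i _ => ?_
    rw [Int.cast_mul, Int.cast_mul, ← key q₁ i.1 (by omega), ← key q₂ i.2 (by omega)]
    ring
  obtain ⟨z, hz⟩ := this
  have hpos : 0 < (q₁.den : ℝ) ^ m * (q₂.den : ℝ) ^ m := by positivity
  have hle : (q₁.den : ℝ) ^ m * (q₂.den : ℝ) ^ m ≤ H ^ (2 * m) := by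
    rw [two_mul, pow_add]; gcongr
  have hz1 : |(z : ℝ)| < 1 := by
    rw [← hz, abs_mul, abs_of_pos hpos]
    have hHp : 0 < H ^ (2 * m) := by positivity
    rw [lt_div_iff₀ hHp] at hlt
    refine lt_of_le_of_lt ?_ hlt
    gcongr
  have hz0 : z = 0 := by
    have : |z| < 1 := by exact_mod_cast hz1
    exact Int.abs_lt_one_iff.1 this
  rw [hz0, Int.cast_zero] at hz
  exact (mul_eq_zero.1 hz).resolve_right hpos.ne'

lemma local_interp (a b : ℝ) (F : ℕ → ℝ → ℝ) (r : ℕ)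
    (hF : ∀ j, ∀ x ∈ Set.Ioo a b, HasDerivAt (F j) (F (j + 1) x) x)
    (h01 : ∀ x ∈ Set.Ioo a b, 0 ≤ F 0 x ∧ F 0 x ≤ 1)
    (hsign : ∀ j, j ≤ r → (∀ x ∈ Set.Ioo a b, 0 ≤ F j x) ∨ (∀ x ∈ Set.Ioo a b, F j x ≤ 0))
    (ha0 : 0 ≤ a) (hb1 : b ≤ 1)
    (x0 ρ : ℝ) (hρ : 0 < ρ) (ha : a ≤ x0 - ρ) (hb : x0 + ρ ≤ b) (n : ℕ) (hn : 1 ≤ n)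
    (hj : n + 1 ≤ r) (m D : ℕ) (hD : D = (m + 1) ^ 2) (h2n : 2 * n ≤ D)
    (H T : ℝ) (hH : 1 ≤ H) (hT1 : 1 ≤ T)
    (hT : 128 * n * D ^ 2 * (4 ^ m) ^ 2 * (H ^ (2 * m)) ^ 2 ≤ T ^ n) :
    ∃ Q : MvPolynomial (Fin 2) ℝ, Q ≠ 0 ∧ Q.totalDegree ≤ 2 * m ∧
      ∀ x ∈ Set.Ioo a b, |x - x0| ≤ ρ / (24 * T) →
        (∃ q₁ q₂ : ℚ, (x, F 0 x) = ((q₁ : ℝ), (q₂ : ℝ)) ∧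
              (ratHeight q₁ : ℝ) ≤ H ∧ (ratHeight q₂ : ℝ) ≤ H) →
        evalRR Q (x, F 0 x) = 0 := by
  obtain ⟨c, hc, happ⟩ := approx_lemma a b F r hF h01 hsign ha0 hb1 x0 ρ hρ ha hb n hn hj m
  set A : ℝ := 4 ^ m with hA
  set V : ℝ := H ^ (2 * m) with hV
  have hA1 : 1 ≤ A := one_le_pow₀ (by norm_num)
  have hV1 : 1 ≤ V := one_le_pow₀ hH
  have hn1 : (1 : ℝ) ≤ n := by exact_mod_cast hn
  have hD1 : (1 : ℝ) ≤ D := by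
    have : 1 ≤ D := by omega
    exact_mod_cast this
  set Z : ℝ := n * D * A * V with hZ
  have hZ1 : 1 ≤ Z := by
    have e1 : 1 ≤ (n : ℝ) * D := one_le_mul_of_one_le_of_one_le hn1 hD1
    have e2 : 1 ≤ (n : ℝ) * D * A := one_le_mul_of_one_le_of_one_le e1 hA1
    exact one_le_mul_of_one_le_of_one_le e2 hV1
  set B : ℕ := ⌈8 * Z⌉₊ with hB
  have hBl : 8 * Z ≤ B := Nat.le_ceil _
  have hBu : (B : ℝ) ≤ 16 * Z := by
    have := Nat.ceil_lt_add_one (a := 8 * Z) (by linarith)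
    linarith
  have hB1 : 1 ≤ B := by
    have : (1 : ℝ) ≤ B := by linarith
    exact_mod_cast this
  have hη : 0 < 1 / (4 * n * V) := by positivity
  have hBη : 2 * D * A ≤ B * (1 / (4 * n * V)) := by
    rw [mul_one_div, le_div_iff₀ (by positivity)]
    calc 2 * D * A * (4 * n * V) = 8 * Z := by rw [hZ]; ring
      _ ≤ B := hBl
  obtain ⟨α, hα0, hαB, hαη⟩ := pigeon_lemma (ι := Fin (m + 1) × Fin (m + 1)) D n B
    (by simp [hD, sq]) h2n hn hB1 A (1 / (4 * n * V)) (by linarith) hη hBη c hc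
  refine ⟨bipoly m α, bipoly_ne_zero m α hα0, bipoly_deg m α, ?_⟩
  intro x hx hxx ⟨q₁, q₂, hq, hh1, hh2⟩
  have hlt : |evalRR (bipoly m α) (x, F 0 x)| < 1 / V := by
    set t := 24 * (x - x0) / ρ with ht
    have hT0 : 0 < T := by linarith
    have htT : |t| ≤ 1 / T := by
      rw [ht, abs_div, abs_mul, abs_of_pos hρ, abs_of_pos (by norm_num : (0:ℝ) < 24),
        div_le_iff₀ hρ]
      calc 24 * |x - x0| ≤ 24 * (ρ / (24 * T)) := by gcongr
        _ = 1 / T * ρ := by field_simp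
    have ht1 : |t| ≤ 1 := htT.trans (by rw [div_le_one hT0]; exact hT1)
    have htn : |t| ^ n ≤ 1 / T ^ n := by
      rw [← one_div_pow]; gcongr
    have ha := happ x hx t ht ht1
    rw [bipoly_eval]
    have e : ∑ i, (α i : ℝ) * (x ^ (i.1 : ℕ) * F 0 x ^ (i.2 : ℕ)) =
        ∑ i, (α i : ℝ) * (x ^ (i.1 : ℕ) * F 0 x ^ (i.2 : ℕ) - ∑ j ∈ Finset.range n, c i j * t ^ j) +
        ∑ j ∈ Finset.range n, (∑ i, (α i : ℝ) * c i j) * t ^ j := by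
      have : ∑ j ∈ Finset.range n, (∑ i, (α i : ℝ) * c i j) * t ^ j =
          ∑ i, (α i : ℝ) * ∑ j ∈ Finset.range n, c i j * t ^ j := by
        simp only [Finset.sum_mul, Finset.mul_sum]
        rw [Finset.sum_comm]
        refine Finset.sum_congr rfl fun i _ => Finset.sum_congr rfl fun j _ => ?_
        ring
      rw [this, ← Finset.sum_add_distrib]
      refine Finset.sum_congr rfl fun i _ => ?_
      ring
    rw [e]
    refine lt_of_le_of_lt (abs_add_le _ _) ?_
    have z1 : |∑ i, (α i : ℝ) * (x ^ (i.1 : ℕ) * F 0 x ^ (i.2 : ℕ) -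
        ∑ j ∈ Finset.range n, c i j * t ^ j)| ≤ D * (B * (2 * A * (1 / T ^ n))) := by
      refine (Finset.abs_sum_le_sum_abs _ _).trans ?_
      calc _ ≤ ∑ i : Fin (m + 1) × Fin (m + 1), (B : ℝ) * (2 * A * (1 / T ^ n)) := by
            refine Finset.sum_le_sum fun i _ => ?_
            rw [abs_mul]
            have h1 := hαB i
            have h2 : |x ^ (i.1 : ℕ) * F 0 x ^ (i.2 : ℕ) - ∑ j ∈ Finset.range n, c i j * t ^ j| ≤
              2 * A * (1 / T ^ n) := (ha i).trans (by gcongr)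
            exact mul_le_mul h1 h2 (abs_nonneg _) (by positivity)
        _ = _ := by
            rw [Finset.sum_const, nsmul_eq_mul, Finset.card_univ]
            simp [hD, sq]
    have z2 : |∑ j ∈ Finset.range n, (∑ i, (α i : ℝ) * c i j) * t ^ j| ≤ 1 / (4 * V) := by
      refine (Finset.abs_sum_le_sum_abs _ _).trans ?_
      calc _ ≤ ∑ j ∈ Finset.range n, 1 / (4 * n * V) := by
            refine Finset.sum_le_sum fun j hj => ?_
            rw [abs_mul, abs_pow]
            have h1 := hαη j (Finset.mem_range.1 hj)
            have h2 : |t| ^ j ≤ 1 := pow_le_one₀ (abs_nonneg _) ht1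
            calc _ ≤ (1 / (4 * n * V)) * 1 := mul_le_mul h1 h2 (by positivity) hη.le
              _ = _ := mul_one _
        _ = _ := by
            rw [Finset.sum_const, nsmul_eq_mul, Finset.card_range]
            field_simp
    have z3 : D * (B * (2 * A * (1 / T ^ n))) ≤ 1 / (4 * V) := by
      have hTn : 0 < T ^ n := by positivity
      have : D * (B * (2 * A * (1 / T ^ n))) = (2 * D * A * B) / T ^ n := by field_simp
      rw [this, div_le_div_iff₀ hTn (by positivity), one_mul]
      refine le_trans ?_ hT
      calc 2 * D * A * B * (4 * V) ≤ 2 * D * A * (16 * Z) * (4 * V) := by gcongr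
        _ = _ := by rw [hZ]; ring
    have z4 : 1 / (4 * V) + 1 / (4 * V) < 1 / V := by
      rw [← add_div, div_lt_div_iff₀ (by positivity) (by positivity)]
      linarith
    linarith
  rw [hq] at hlt ⊢
  exact bipoly_int m α q₁ q₂ H hh1 hh2 hH hlt

lemma T_bound (k m n D : ℕ) (hk : 1 < k) (hm : m = k / 2) (hD : D = (m + 1) ^ 2) (hn : n = D / 2)
    (H : ℝ) (hH : 1 ≤ H) :
    128 * (n : ℝ) * (D : ℝ) ^ 2 * (4 ^ m) ^ 2 * (H ^ (2 * m)) ^ 2 ≤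
      (147456 * H ^ ((32 : ℝ) / k)) ^ n := by
  have hm1 : 1 ≤ m := by omega
  have hD4 : 4 ≤ D := by rw [hD]; nlinarith
  have hmn : m ≤ n := by
    have : 2 * m ≤ D := by rw [hD]; nlinarith
    omega
  have hD3 : D ≤ 3 * n := by omega
  have hk8 : m * k ≤ 8 * n := by
    have h1 : k ≤ 2 * m + 1 := by omega
    have h2 : m * k ≤ m * (2 * m + 1) := Nat.mul_le_mul_left _ h1
    have h3 : D ≤ 2 * n + 1 := by omega
    have h4 : D = m ^ 2 + 2 * m + 1 := by rw [hD]; ring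
    nlinarith
  rw [mul_pow]
  have b1 : 128 * (n : ℝ) * (D : ℝ) ^ 2 * (4 ^ m) ^ 2 ≤ 147456 ^ n := by
    have n1 : (n : ℝ) ≤ 2 ^ n := by exact_mod_cast (Nat.lt_two_pow_self (n := n)).le
    have d1 : (D : ℝ) ≤ 3 * n := by exact_mod_cast hD3
    have m1 : (4 : ℝ) ^ m ≤ 4 ^ n := pow_le_pow_right₀ (by norm_num) hmn
    have c1 : (1152 : ℝ) ≤ 1152 ^ n := le_self_pow₀ (by norm_num) (by omega)
    calc 128 * (n : ℝ) * (D : ℝ) ^ 2 * (4 ^ m) ^ 2 ≤ 128 * (2 ^ n) * (3 * 2 ^ n) ^ 2 * (4 ^ n) ^ 2 := by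
          have : (D : ℝ) ≤ 3 * 2 ^ n := by linarith
          gcongr
      _ = 1152 * (2 ^ n * 2 ^ n * 2 ^ n * 4 ^ n * 4 ^ n) := by ring
      _ ≤ 1152 ^ n * (2 ^ n * 2 ^ n * 2 ^ n * 4 ^ n * 4 ^ n) := by gcongr
      _ = (147456) ^ n := by
        simp only [← mul_pow]; norm_num
  have b2 : (H ^ (2 * m)) ^ 2 ≤ (H ^ ((32 : ℝ) / k)) ^ n := by
    have hH0 : 0 ≤ H := by linarith
    rw [← pow_mul, ← Real.rpow_natCast, ← Real.rpow_natCast, ← Real.rpow_mul hH0]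
    refine Real.rpow_le_rpow_of_exponent_le hH ?_
    have hk0 : (0 : ℝ) < k := by exact_mod_cast (by omega : 0 < k)
    rw [div_mul_eq_mul_div, le_div_iff₀ hk0]
    have : (m : ℝ) * k ≤ 8 * n := by exact_mod_cast hk8
    push_cast
    nlinarith
  have : 0 ≤ (H ^ (2 * m)) ^ 2 := by positivity
  exact mul_le_mul b1 b2 this (by positivity)

/-! ### Part 7: covering -/

lemma rat_sep (q₁ q₂ : ℚ) (H : ℝ) (h1 : (ratHeight q₁ : ℝ) ≤ H) (h2 : (ratHeight q₂ : ℝ) ≤ H)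
    (hH : 1 ≤ H) (h : |(q₁ : ℝ) - q₂| < 1 / H ^ 2) : q₁ = q₂ := by
  have d1 : (q₁.den : ℝ) ≤ H := le_trans (by exact_mod_cast le_max_right _ _) h1
  have d2 : (q₂.den : ℝ) ≤ H := le_trans (by exact_mod_cast le_max_right _ _) h2
  have p1 : (0 : ℝ) < q₁.den := by exact_mod_cast q₁.den_pos
  have p2 : (0 : ℝ) < q₂.den := by exact_mod_cast q₂.den_pos
  have e1 : (q₁ : ℝ) * q₁.den = q₁.num := by exact_mod_cast Rat.mul_den_eq_num q₁
  have e2 : (q₂ : ℝ) * q₂.den = q₂.num := by exact_mod_cast Rat.mul_den_eq_num q₂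
  have hpos : 0 < (q₁.den : ℝ) * (q₂.den : ℝ) := by positivity
  have hz : ((q₁ : ℝ) - q₂) * ((q₁.den : ℝ) * (q₂.den : ℝ)) =
      ((q₁.num * q₂.den - q₂.num * q₁.den : ℤ) : ℝ) := by
    push_cast
    rw [← e1, ← e2]; ring
  have hle : (q₁.den : ℝ) * (q₂.den : ℝ) ≤ H ^ 2 := by rw [sq]; gcongr
  have hz1 : |((q₁.num * q₂.den - q₂.num * q₁.den : ℤ) : ℝ)| < 1 := by
    rw [← hz, abs_mul, abs_of_pos hpos]
    rw [lt_div_iff₀ (by positivity)] at h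
    refine lt_of_le_of_lt ?_ h
    gcongr
  have hz0 : q₁.num * q₂.den - q₂.num * q₁.den = 0 := by
    have : |q₁.num * q₂.den - q₂.num * q₁.den| < 1 := by exact_mod_cast hz1
    exact Int.abs_lt_one_iff.1 this
  rw [hz0, Int.cast_zero] at hz
  have := (mul_eq_zero.1 hz).resolve_right hpos.ne'
  have h3 : (q₁ : ℝ) = q₂ := by linarith
  exact_mod_cast h3

lemma end_piece (a δ H : ℝ) (hH : 1 ≤ H) (hδ : 2 * δ < 1 / H ^ 2) :
    ∃ Q : MvPolynomial (Fin 2) ℝ, Q ≠ 0 ∧ Q.totalDegree ≤ 1 ∧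
      ∀ q₁ : ℚ, (ratHeight q₁ : ℝ) ≤ H → |(q₁ : ℝ) - a| ≤ δ → ∀ y, evalRR Q ((q₁ : ℝ), y) = 0 := by
  have main : ∀ z : ℝ, (X 0 - C z : MvPolynomial (Fin 2) ℝ) ≠ 0 ∧
      (X 0 - C z : MvPolynomial (Fin 2) ℝ).totalDegree ≤ 1 := by
    intro z
    constructor
    · intro h
      have := congrArg (fun Q => evalRR Q (z + 1, 0)) h
      simp [evalRR] at this
    · refine (totalDegree_sub _ _).trans ?_
      simp [totalDegree_X]
  by_cases hex : ∃ q₁ : ℚ, (ratHeight q₁ : ℝ) ≤ H ∧ |(q₁ : ℝ) - a| ≤ δ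
  · obtain ⟨q, hq, hqa⟩ := hex
    refine ⟨X 0 - C (q : ℝ), (main _).1, (main _).2, ?_⟩
    intro q₁ h1 h2 y
    have : q₁ = q := by
      refine rat_sep q₁ q H h1 hq hH (lt_of_le_of_lt ?_ hδ)
      rw [abs_le] at *
      constructor <;> linarith [hqa.1, hqa.2, h2.1, h2.2]
    subst this
    simp [evalRR]
  · refine ⟨X 0 - C 0, (main _).1, (main _).2, ?_⟩
    intro q₁ h1 h2
    exact absurd ⟨q₁, h1, h2⟩ hex

lemma geom_step (δ : ℕ → ℝ) (M : ℕ) (s : ℝ) (h1 : δ M < s) (h0 : s ≤ δ 0) :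
    ∃ i < M, δ (i + 1) < s ∧ s ≤ δ i := by
  induction M with
  | zero => linarith
  | succ M ih =>
    by_cases h : s ≤ δ M
    · exact ⟨M, by omega, h1, h⟩
    · obtain ⟨i, hi, h2⟩ := ih (not_le.1 h)
      exact ⟨i, by omega, h2⟩

lemma geom_close (L w s : ℝ) (hL : 0 < L) (hw : 1 ≤ w) (i : ℕ)
    (h1 : L / 2 / (1 + 1 / w) ^ (i + 1) < s) (h2 : s ≤ L / 2 / (1 + 1 / w) ^ i) :
    |s - L / 2 / (1 + 1 / w) ^ i| ≤ L / 2 / (1 + 1 / w) ^ i / w := by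
  have hw0 : 0 < w := by linarith
  set δ := L / 2 / (1 + 1 / w) ^ i with hδ
  have hδ0 : 0 < δ := by positivity
  have e : L / 2 / (1 + 1 / w) ^ (i + 1) = δ / (1 + 1 / w) := by
    rw [hδ, pow_succ]; field_simp
  rw [e] at h1
  rw [abs_le]
  have h3 : δ - δ / w ≤ δ / (1 + 1 / w) := by
    rw [le_div_iff₀ (by positivity)]
    have : (δ - δ / w) * (1 + 1 / w) = δ - δ / w ^ 2 := by field_simp; ring
    rw [this]
    have : 0 ≤ δ / w ^ 2 := by positivity
    linarith
  have : 0 ≤ δ / w := by positivity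
  constructor <;> linarith

lemma pow_big (k : ℕ) (hk : 1 < k) (H w : ℝ) (hH : 1 ≤ H) (hw : 1 ≤ w) :
    H ^ 2 < (1 + 1 / w) ^ (⌈w⌉₊ * (2 * k * ⌈H ^ ((1 : ℝ) / k)⌉₊)) := by
  have hw0 : 0 < w := by linarith
  set y := H ^ ((1 : ℝ) / k) with hy
  have hy0 : 0 ≤ y := by positivity
  have h1 : (2 : ℝ) ≤ (1 + 1 / w) ^ ⌈w⌉₊ := by
    have b := one_add_mul_le_pow (a := 1 / w) (by have : 0 ≤ 1 / w := by positivity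
                                                  linarith) ⌈w⌉₊
    have : 1 ≤ (⌈w⌉₊ : ℝ) * (1 / w) := by
      rw [mul_one_div, le_div_iff₀ hw0, one_mul]; exact Nat.le_ceil w
    linarith
  have h2 : y < 2 ^ ⌈y⌉₊ := by
    have a1 : (⌈y⌉₊ : ℝ) < 2 ^ ⌈y⌉₊ := by exact_mod_cast Nat.lt_two_pow_self
    exact lt_of_le_of_lt (Nat.le_ceil y) a1
  have h3 : y ^ k = H := by
    rw [hy, one_div]
    exact Real.rpow_inv_natCast_pow (by linarith) (by omega)
  calc H ^ 2 = y ^ (2 * k) := by rw [mul_comm 2 k, pow_mul, h3]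
    _ < (2 ^ ⌈y⌉₊) ^ (2 * k) := pow_lt_pow_left₀ h2 hy0 (by omega)
    _ = 2 ^ (2 * k * ⌈y⌉₊) := by rw [← pow_mul]; ring_nf
    _ ≤ ((1 + 1 / w) ^ ⌈w⌉₊) ^ (2 * k * ⌈y⌉₊) := by gcongr
    _ = _ := by rw [← pow_mul]

lemma M_bound (k : ℕ) (hk : 1 < k) (H w : ℝ) (hH : 1 ≤ H)
    (hw : w = 24 * (147456 * H ^ ((32 : ℝ) / k))) :
    1 ≤ w ∧ 1 ≤ ⌈w⌉₊ * (2 * k * ⌈H ^ ((1 : ℝ) / k)⌉₊) ∧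
    (((2 * (⌈w⌉₊ * (2 * k * ⌈H ^ ((1 : ℝ) / k)⌉₊)) + 2 : ℕ)) : ℝ) ≤
      (48 * 24 * 147456) * (k : ℝ) ^ (1 : ℝ) * H ^ ((33 : ℝ) / k) := by
  have hk0 : (0 : ℝ) < k := by exact_mod_cast (by omega : 0 < k)
  have a1 : 1 ≤ H ^ ((32 : ℝ) / k) := Real.one_le_rpow hH (by positivity)
  have a2 : 1 ≤ H ^ ((1 : ℝ) / k) := Real.one_le_rpow hH (by positivity)
  have e : H ^ ((33 : ℝ) / k) = H ^ ((32 : ℝ) / k) * H ^ ((1 : ℝ) / k) := by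
    rw [← Real.rpow_add (by linarith)]; congr 1; ring
  have hw1 : 1 ≤ w := by rw [hw]; linarith
  set y := H ^ ((1 : ℝ) / k) with hy
  have c1 : (⌈w⌉₊ : ℝ) ≤ 2 * w := by
    have := Nat.ceil_lt_add_one (a := w) (by linarith)
    linarith
  have c2 : (⌈y⌉₊ : ℝ) ≤ 2 * y := by
    have := Nat.ceil_lt_add_one (a := y) (by linarith)
    linarith
  have n1 : 1 ≤ ⌈w⌉₊ := Nat.one_le_ceil_iff.2 (by linarith)
  have n2 : 1 ≤ ⌈y⌉₊ := Nat.one_le_ceil_iff.2 (by linarith)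
  have hM1 : 1 ≤ ⌈w⌉₊ * (2 * k * ⌈y⌉₊) :=
    Nat.one_le_iff_ne_zero.2 (by
      refine mul_ne_zero (by omega) (mul_ne_zero (by omega) (by omega)))
  refine ⟨hw1, hM1, ?_⟩
  have hM1' : (1 : ℝ) ≤ (⌈w⌉₊ : ℝ) * (2 * k * (⌈y⌉₊ : ℝ)) := by exact_mod_cast hM1
  have hM2 : (⌈w⌉₊ : ℝ) * (2 * k * (⌈y⌉₊ : ℝ)) ≤ (2 * w) * (2 * k * (2 * y)) := by gcongr
  push_cast
  rw [Real.rpow_one, e]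
  have e3 : (2 * w) * (2 * k * (2 * y)) = 8 * 24 * 147456 * (k * (H ^ ((32 : ℝ) / k) * y)) := by
    rw [hw]; ring
  have : 0 ≤ k * (H ^ ((32 : ℝ) / k) * y) := by positivity
  linarith

lemma covering (U : Set ℝ) (hU : IsPreconnected U) (hU01 : U ⊆ Set.Icc 0 1)
    (F : ℕ → ℝ → ℝ) (k r : ℕ) (hk : 1 < k) (hr : r = (k + 1) * (k + 2) / 2)
    (hF : ∀ j, ∀ x ∈ U, HasDerivAt (F j) (F (j + 1) x) x)
    (h01 : ∀ x ∈ U, 0 ≤ F 0 x ∧ F 0 x ≤ 1)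
    (hsign : ∀ j, j ≤ r → (∀ x ∈ U, F j x = 0) ∨ (∀ x ∈ U, F j x ≠ 0))
    (H : ℝ) (hH : 1 ≤ H) :
    ∃ s : Finset (MvPolynomial (Fin 2) ℝ),
      (s.card : ℝ) ≤ (48 * 24 * 147456) * (k : ℝ) ^ (1 : ℝ) * H ^ ((33 : ℝ) / k) ∧
      (∀ Q ∈ s, Q ≠ 0 ∧ Q.totalDegree ≤ k) ∧
      ∀ x ∈ U, (∃ q₁ q₂ : ℚ, (x, F 0 x) = ((q₁ : ℝ), (q₂ : ℝ)) ∧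
              (ratHeight q₁ : ℝ) ≤ H ∧ (ratHeight q₂ : ℝ) ≤ H) →
        ∃ Q ∈ s, evalRR Q (x, F 0 x) = 0 := by
  classical
  rcases U.eq_empty_or_nonempty with rfl | hne
  · refine ⟨∅, ?_, by simp, by simp⟩
    simp only [Finset.card_empty, Nat.cast_zero]
    positivity
  have hbb : BddBelow U := ⟨0, fun x hx => (hU01 hx).1⟩
  have hba : BddAbove U := ⟨1, fun x hx => (hU01 hx).2⟩
  set a := sInf U with ha
  set b := sSup U with hb
  have hsub : Set.Ioo a b ⊆ U := IsConnected.Ioo_csInf_csSup_subset ⟨hne, hU⟩ hbb hba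
  have ha0 : 0 ≤ a := le_csInf hne fun x hx => (hU01 hx).1
  have hb1 : b ≤ 1 := csSup_le hne fun x hx => (hU01 hx).2
  have hUI : ∀ x ∈ U, a ≤ x ∧ x ≤ b := fun x hx => ⟨csInf_le hbb hx, le_csSup hba hx⟩
  have hab : a ≤ b := by
    obtain ⟨x, hx⟩ := hne
    exact (hUI x hx).1.trans (hUI x hx).2
  set w : ℝ := 24 * (147456 * H ^ ((32 : ℝ) / k)) with hw
  obtain ⟨hw1, hM1, hMb⟩ := M_bound k hk H w hH hw
  have hbig := pow_big k hk H w hH hw1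
  set M := ⌈w⌉₊ * (2 * k * ⌈H ^ ((1 : ℝ) / k)⌉₊) with hM
  set δ : ℕ → ℝ := fun i => (b - a) / 2 / (1 + 1 / w) ^ i with hδ
  have hw0 : 0 < w := by linarith
  have hδM : 2 * δ M < 1 / H ^ 2 := by
    have h1 : 2 * δ M = (b - a) / (1 + 1 / w) ^ M := by simp only [hδ]; ring
    rw [h1, div_lt_div_iff₀ (by positivity) (by positivity), one_mul]
    refine lt_of_le_of_lt ?_ hbig
    have : 0 ≤ H ^ 2 := by positivity
    nlinarith
  obtain ⟨Qa, hQa0, hQa1, hQa⟩ := end_piece a (δ M) H hH hδM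
  obtain ⟨Qb, hQb0, hQb1, hQb⟩ := end_piece b (δ M) H hH hδM
  -- local pieces
  have hloc : ∀ x0 ρ : ℝ, 0 < ρ → a ≤ x0 - ρ → x0 + ρ ≤ b →
      ∃ Q : MvPolynomial (Fin 2) ℝ, Q ≠ 0 ∧ Q.totalDegree ≤ k ∧
      ∀ x ∈ Set.Ioo a b, |x - x0| ≤ ρ / w →
        (∃ q₁ q₂ : ℚ, (x, F 0 x) = ((q₁ : ℝ), (q₂ : ℝ)) ∧
              (ratHeight q₁ : ℝ) ≤ H ∧ (ratHeight q₂ : ℝ) ≤ H) →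
        evalRR Q (x, F 0 x) = 0 := by
    intro x0 ρ hρ h1 h2
    set m := k / 2 with hm
    set D := (m + 1) ^ 2 with hD
    set n := D / 2 with hn
    have hm1 : 1 ≤ m := by omega
    have hD4 : 4 ≤ D := by rw [hD]; nlinarith
    have hnr : n + 1 ≤ r := by
      have h5 : 2 * m ≤ k := by omega
      have h6 : D ≤ (k + 1) * (k + 2) - 2 := by
        have : D + 2 ≤ (k + 1) * (k + 2) := by rw [hD]; nlinarith
        omega
      have h7 : 2 ≤ (k + 1) * (k + 2) := by nlinarith
      omega
    have hsgn : ∀ j, j ≤ r → (∀ x ∈ Set.Ioo a b, 0 ≤ F j x) ∨ (∀ x ∈ Set.Ioo a b, F j x ≤ 0) := by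
      intro j hj
      refine sign_const a b (F j)
        (fun x hx => (hF j x (hsub hx)).continuousAt.continuousWithinAt) ?_
      rcases hsign j hj with h | h
      · exact Or.inl fun x hx => h x (hsub hx)
      · exact Or.inr fun x hx => h x (hsub hx)
    have hT1 : 1 ≤ 147456 * H ^ ((32 : ℝ) / k) := by
      have : 1 ≤ H ^ ((32 : ℝ) / k) := Real.one_le_rpow hH (by positivity)
      linarith
    obtain ⟨Q, hQ0, hQ1, hQ⟩ := local_interp a b F r (fun j x hx => hF j x (hsub hx))
      (fun x hx => h01 x (hsub hx)) hsgn ha0 hb1 x0 ρ hρ h1 h2 n (by omega) hnr m D hD (by omega)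
      H (147456 * H ^ ((32 : ℝ) / k)) hH hT1 (T_bound k m n D hk hm hD hn H hH)
    exact ⟨Q, hQ0, hQ1.trans (by omega), hQ⟩
  have hloc' : ∀ x0 ρ : ℝ, ∃ Q : MvPolynomial (Fin 2) ℝ, Q ≠ 0 ∧ Q.totalDegree ≤ k ∧
      (0 < ρ → a ≤ x0 - ρ → x0 + ρ ≤ b → ∀ x ∈ Set.Ioo a b, |x - x0| ≤ ρ / w →
        (∃ q₁ q₂ : ℚ, (x, F 0 x) = ((q₁ : ℝ), (q₂ : ℝ)) ∧
              (ratHeight q₁ : ℝ) ≤ H ∧ (ratHeight q₂ : ℝ) ≤ H) →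
        evalRR Q (x, F 0 x) = 0) := by
    intro x0 ρ
    by_cases h : 0 < ρ ∧ a ≤ x0 - ρ ∧ x0 + ρ ≤ b
    · obtain ⟨Q, h1, h2, h3⟩ := hloc x0 ρ h.1 h.2.1 h.2.2
      exact ⟨Q, h1, h2, fun _ _ _ => h3⟩
    · exact ⟨1, one_ne_zero, by simp, fun h1 h2 h3 => absurd ⟨h1, h2, h3⟩ h⟩
  choose G hG0 hG1 hG using hloc'
  refine ⟨insert Qa (insert Qb ((Finset.range M).image (fun i => G (a + δ i) (δ i)) ∪
    (Finset.range M).image (fun i => G (b - δ i) (δ i)))), ?_, ?_, ?_⟩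
  · refine le_trans ?_ hMb
    have c1 : ((Finset.range M).image (fun i => G (a + δ i) (δ i))).card ≤ M := by
      simpa using Finset.card_image_le (s := Finset.range M) (f := fun i => G (a + δ i) (δ i))
    have c2 : ((Finset.range M).image (fun i => G (b - δ i) (δ i))).card ≤ M := by
      simpa using Finset.card_image_le (s := Finset.range M) (f := fun i => G (b - δ i) (δ i))
    have c3 := Finset.card_union_le ((Finset.range M).image (fun i => G (a + δ i) (δ i)))
      ((Finset.range M).image (fun i => G (b - δ i) (δ i)))
    have c4 := Finset.card_insert_le Qb ((Finset.range M).image (fun i => G (a + δ i) (δ i)) ∪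
      (Finset.range M).image (fun i => G (b - δ i) (δ i)))
    have c5 := Finset.card_insert_le Qa (insert Qb
      ((Finset.range M).image (fun i => G (a + δ i) (δ i)) ∪
      (Finset.range M).image (fun i => G (b - δ i) (δ i))))
    exact_mod_cast (by omega :
      (insert Qa (insert Qb ((Finset.range M).image (fun i => G (a + δ i) (δ i)) ∪
        (Finset.range M).image (fun i => G (b - δ i) (δ i))))).card ≤ 2 * M + 2)
  · intro Q hQ
    simp only [Finset.mem_insert, Finset.mem_union, Finset.mem_image, Finset.mem_range] at hQ
    rcases hQ with rfl | rfl | ⟨i, _, rfl⟩ | ⟨i, _, rfl⟩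
    · exact ⟨hQa0, hQa1.trans hk.le⟩
    · exact ⟨hQb0, hQb1.trans hk.le⟩
    · exact ⟨hG0 _ _, hG1 _ _⟩
    · exact ⟨hG0 _ _, hG1 _ _⟩
  · intro x hx hq
    obtain ⟨hxa, hxb⟩ := hUI x hx
    by_cases h1 : x - a ≤ δ M
    · refine ⟨Qa, by simp, ?_⟩
      obtain ⟨q₁, q₂, e, hh1, hh2⟩ := hq
      rw [e]
      have e1 := congrArg Prod.fst e
      simp only at e1
      refine hQa q₁ hh1 ?_ _
      rw [← e1, abs_of_nonneg (by linarith)]; exact h1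
    by_cases h2 : b - x ≤ δ M
    · refine ⟨Qb, by simp, ?_⟩
      obtain ⟨q₁, q₂, e, hh1, hh2⟩ := hq
      rw [e]
      have e1 := congrArg Prod.fst e
      simp only at e1
      refine hQb q₁ hh1 ?_ _
      rw [← e1, abs_sub_comm, abs_of_nonneg (by linarith)]; exact h2
    have hδ0 : ∀ i, 0 ≤ δ i := fun i => by
      have : 0 ≤ b - a := by linarith
      simp only [hδ]; positivity
    have hM0 := hδ0 M
    push Not at h1 h2
    have hxI : x ∈ Set.Ioo a b := ⟨by linarith, by linarith⟩
    have hL : 0 < b - a := by linarith [hxI.1, hxI.2]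
    have hδp : ∀ i, 0 < δ i := fun i => by simp only [hδ]; positivity
    have hδh : ∀ i, δ i ≤ (b - a) / 2 := fun i => by
      simp only [hδ]
      refine div_le_self (by linarith) (one_le_pow₀ ?_)
      have : 0 ≤ 1 / w := by positivity
      linarith
    have hδz : δ 0 = (b - a) / 2 := by simp [hδ]
    by_cases h3 : x - a ≤ (b - a) / 2
    · obtain ⟨i, hi, h4, h5⟩ := geom_step δ M (x - a) h1 (by rw [hδz]; exact h3)
      have h6 := geom_close (b - a) w (x - a) hL hw1 i h4 h5
      refine ⟨G (a + δ i) (δ i), ?_, ?_⟩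
      · simp only [Finset.mem_insert, Finset.mem_union, Finset.mem_image, Finset.mem_range]
        exact Or.inr (Or.inr (Or.inl ⟨i, hi, rfl⟩))
      · refine hG (a + δ i) (δ i) (hδp i) (by linarith) (by linarith [hδh i]) x hxI ?_ hq
        rw [← sub_sub]; exact h6
    · obtain ⟨i, hi, h4, h5⟩ := geom_step δ M (b - x) h2 (by rw [hδz]; linarith)
      have h6 := geom_close (b - a) w (b - x) hL hw1 i h4 h5
      refine ⟨G (b - δ i) (δ i), ?_, ?_⟩
      · simp only [Finset.mem_insert, Finset.mem_union, Finset.mem_image, Finset.mem_range]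
        exact Or.inr (Or.inr (Or.inr ⟨i, hi, rfl⟩))
      · refine hG (b - δ i) (δ i) (hδp i) (by linarith [hδh i]) (by linarith) x hxI ?_ hq
        rw [show x - (b - δ i) = -(b - x - δ i) by ring, abs_neg]; exact h6

/-! ### Part 8: conclusion -/

lemma pderiv_totalDegree_lt (P : MvPolynomial (Fin 2) ℝ) (i : Fin 2) (hd : 1 ≤ P.totalDegree) :
    (pderiv i P).totalDegree < P.totalDegree := by
  rw [totalDegree, Finset.sup_lt_iff (by simp; omega)]
  intro s hs
  rw [mem_support_iff, coeff_pderiv] at hs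
  have h1 : s + Finsupp.single i 1 ∈ P.support := by
    rw [mem_support_iff]; exact left_ne_zero_of_mul hs
  have h2 := le_totalDegree h1
  rw [Finsupp.sum_add_index' (by simp) (by intros; rfl), Finsupp.sum_single_index rfl] at h2
  omega

lemma not_dvd_of_deg (P g : MvPolynomial (Fin 2) ℝ) (hg : g ≠ 0)
    (h : g.totalDegree < P.totalDegree) : ¬ P ∣ g := by
  intro hdvd
  have := totalDegree_le_of_dvd_of_isDomain hdvd hg
  omega

theorem component_interpolation :
    ∃ c e c' : ℝ, 0 < c ∧ 0 < e ∧ 0 < c' ∧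
      ∀ (P : MvPolynomial (Fin 2) ℝ), Irreducible P →
      ∀ d : ℕ, d = P.totalDegree → 2 ≤ d →
      pderiv 0 P ≠ 0 → pderiv 1 P ≠ 0 →
      ∀ k : ℕ, 1 < k →
      ∀ r : ℕ, r = (k + 1) * (k + 2) / 2 →
      ∀ Dx Dy : RatFunc2 → RatFunc2,
        (∀ a b, Dx (a + b) = Dx a + Dx b) →
        (∀ a b, Dx (a * b) = a * Dx b + Dx a * b) →
        (∀ a b, Dy (a + b) = Dy a + Dy b) →
        (∀ a b, Dy (a * b) = a * Dy b + Dy a * b) →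
        (∀ q : MvPolynomial (Fin 2) ℝ,
          Dx (toRF q) = toRF (pderiv 0 q) -
            (toRF (pderiv 0 P) / toRF (pderiv 1 P)) * toRF (pderiv 1 q)) →
        (∀ q : MvPolynomial (Fin 2) ℝ,
          Dy (toRF q) = toRF (pderiv 1 q) -
            (toRF (pderiv 1 P) / toRF (pderiv 0 P)) * toRF (pderiv 0 q)) →
      ∀ yx xy : ℕ → MvPolynomial (Fin 2) ℝ,
        yx 0 = X 1 → xy 0 = X 0 →
        (∀ j : ℕ, 1 ≤ j →
          toRF (yx j) = (toRF (pderiv 1 P)) ^ (2 * j - 1) * Dx^[j] (toRF (X 1))) →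
        (∀ j : ℕ, 1 ≤ j →
          toRF (xy j) = (toRF (pderiv 0 P)) ^ (2 * j - 1) * Dy^[j] (toRF (X 0))) →
      ∀ p₀ : ℝ × ℝ,
        p₀ ∈ ({p | evalRR P p = 0 ∧ p.1 ∈ Set.Icc (0:ℝ) 1 ∧ p.2 ∈ Set.Icc (0:ℝ) 1}
                \ PiSet P r yx xy) →
      ∀ Γ₀ : Set (ℝ × ℝ),
        Γ₀ = connectedComponentIn
          ({p | evalRR P p = 0 ∧ p.1 ∈ Set.Icc (0:ℝ) 1 ∧ p.2 ∈ Set.Icc (0:ℝ) 1}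
            \ PiSet P r yx xy) p₀ →
      ∀ H : ℝ, 2 ≤ H →
      ∃ N : ℕ, (N : ℝ) ≤ c * (k : ℝ) ^ e * H ^ (c' / (k : ℝ)) ∧
        ∃ Q : Fin N → MvPolynomial (Fin 2) ℝ,
          (∀ i, Q i ≠ 0 ∧ (Q i).totalDegree ≤ k) ∧
          ∀ p ∈ Γ₀, (∃ q₁ q₂ : ℚ, p = ((q₁ : ℝ), (q₂ : ℝ)) ∧
              (ratHeight q₁ : ℝ) ≤ H ∧ (ratHeight q₂ : ℝ) ≤ H) →
            ∃ i, evalRR (Q i) p = 0 := by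
  refine ⟨48 * 24 * 147456, 1, 33, by norm_num, by norm_num, by norm_num, ?_⟩
  intro P hP d hd hd2 hPx hPy k hk r hr Dx Dy hDa hDm _ _ hDx _ yx xy hyx0 hxy0 hyx _ p₀ hp₀ Γ₀ hΓ H hH
  classical
  set S := ({p : ℝ × ℝ | evalRR P p = 0 ∧ p.1 ∈ Set.Icc (0:ℝ) 1 ∧ p.2 ∈ Set.Icc (0:ℝ) 1}
                \ PiSet P r yx xy) with hS
  -- nonvanishing on `S`
  have nonvan : ∀ g : MvPolynomial (Fin 2) ℝ, ¬ P ∣ g →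
      (g = pderiv 0 P ∨ g = pderiv 1 P ∨
      g = pderiv 0 P + pderiv 1 P ∨ g = pderiv 0 P - pderiv 1 P ∨
      g = X 0 + 1 ∨ g = X 0 - 1 ∨ g = X 1 + 1 ∨ g = X 1 - 1 ∨
      ∃ j ≤ r, g = yx j ∨ g = xy j) → ∀ p ∈ S, evalRR g p ≠ 0 := by
    intro g hg hlist p hp h0
    exact hp.2 ⟨hp.1.1, g, hlist, isolated_of_finite p _ (finite_common P g hP hg) ⟨h0, hp.1.1⟩⟩
  have hdeg : 2 ≤ P.totalDegree := by omega
  have nd_py : ¬ P ∣ pderiv 1 P :=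
    not_dvd_of_deg P _ hPy (pderiv_totalDegree_lt P 1 (by omega))
  have nd_X : ∀ i : Fin 2, ¬ P ∣ X i := fun i =>
    not_dvd_of_deg P _ (X_ne_zero i) (by rw [totalDegree_X]; omega)
  have nd_X1 : ∀ i : Fin 2, ¬ P ∣ X i - 1 := fun i => by
    refine not_dvd_of_deg P _ ?_ ?_
    · intro h
      have := congrArg (MvPolynomial.eval (fun _ => (0 : ℝ))) h
      simp at this
    · refine lt_of_le_of_lt (totalDegree_sub _ _) ?_
      simp [totalDegree_X]; omega
  let W : Set (ℝ × ℝ) := {p | evalRR (pderiv 1 P) p ≠ 0 ∧ (0 < p.1 ∧ p.1 < 1) ∧ (0 < p.2 ∧ p.2 < 1) ∧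
    ∀ j ∈ Finset.range (r + 1), ¬ P ∣ yx j → evalRR (yx j) p ≠ 0}
  have hW : IsOpen W := by
    have o1 : IsOpen {p : ℝ × ℝ | evalRR (pderiv 1 P) p ≠ 0} :=
      isOpen_ne_fun (continuous_evalRR _) continuous_const
    have o2 : IsOpen {p : ℝ × ℝ | 0 < p.1 ∧ p.1 < 1} :=
      (isOpen_lt continuous_const continuous_fst).inter (isOpen_lt continuous_fst continuous_const)
    have o3 : IsOpen {p : ℝ × ℝ | 0 < p.2 ∧ p.2 < 1} :=
      (isOpen_lt continuous_const continuous_snd).inter (isOpen_lt continuous_snd continuous_const)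
    have o4 : IsOpen {p : ℝ × ℝ | ∀ j ∈ Finset.range (r + 1), ¬ P ∣ yx j → evalRR (yx j) p ≠ 0} := by
      have e : {p : ℝ × ℝ | ∀ j ∈ Finset.range (r + 1), ¬ P ∣ yx j → evalRR (yx j) p ≠ 0} =
          ⋂ j ∈ Finset.range (r + 1), {p : ℝ × ℝ | ¬ P ∣ yx j → evalRR (yx j) p ≠ 0} := by
        ext p; simp
      rw [e]
      refine isOpen_biInter_finset fun j _ => ?_
      by_cases hj : P ∣ yx j
      · simp [hj]
      · simp only [hj, not_false_eq_true, forall_const]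
        exact isOpen_ne_fun (continuous_evalRR _) continuous_const
    exact o1.inter (o2.inter (o3.inter o4))
  have hSW : S ⊆ {p | evalRR P p = 0} ∩ W := by
    intro p hp
    obtain ⟨⟨hp0, hp1, hp2⟩, -⟩ := id hp
    refine ⟨hp0, nonvan _ nd_py (by simp) p hp, ⟨?_, ?_⟩, ⟨?_, ?_⟩, ?_⟩
    · have := nonvan (xy 0) (by rw [hxy0]; exact nd_X 0)
        (by right; right; right; right; right; right; right; right
            exact ⟨0, by omega, Or.inr rfl⟩) p hp
      rw [hxy0] at this
      simp only [evalRR, eval_X, Matrix.cons_val_zero] at this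
      exact lt_of_le_of_ne hp1.1 (Ne.symm this)
    · have := nonvan (X 0 - 1) (nd_X1 0) (by simp) p hp
      simp only [evalRR, map_sub, map_one, eval_X, Matrix.cons_val_zero] at this
      exact lt_of_le_of_ne hp1.2 (fun h => this (by rw [h]; simp))
    · have := nonvan (yx 0) (by rw [hyx0]; exact nd_X 1)
        (by right; right; right; right; right; right; right; right
            exact ⟨0, by omega, Or.inl rfl⟩) p hp
      rw [hyx0] at this
      simp only [evalRR, eval_X, Matrix.cons_val_one, Matrix.cons_val_fin_one] at this
      exact lt_of_le_of_ne hp2.1 (Ne.symm this)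
    · have := nonvan (X 1 - 1) (nd_X1 1) (by simp) p hp
      simp only [evalRR, map_sub, map_one, eval_X, Matrix.cons_val_one, Matrix.cons_val_fin_one] at this
      exact lt_of_le_of_ne hp2.2 (fun h => this (by rw [h]; simp))
    · intro j hj hnd
      refine nonvan (yx j) hnd ?_ p hp
      right; right; right; right; right; right; right; right
      exact ⟨j, by have := Finset.mem_range.1 hj; omega, Or.inl rfl⟩
  obtain ⟨U, f, hU, hcomp, hUW, hfd⟩ := graph_of_component P W hW (fun p hp => hp.1) p₀
  have h1 := yx_one P hPy Dx hDx yx hyx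
  have h2 := yx_succ P hPy Dx hDm hDx yx hyx
  let F : ℕ → ℝ → ℝ := fun j t =>
    evalRR (yx j) (t, f t) / (evalRR (pderiv 1 P) (t, f t)) ^ (2 * j - 1)
  have hF0 : ∀ x, F 0 x = f x := by intro x; simp [F, hyx0, evalRR]
  obtain ⟨s, hs1, hs2, hs3⟩ := covering U hU
    (fun x hx => ⟨(hUW x hx).2.2.1.1.le, (hUW x hx).2.2.1.2.le⟩) F k r hk hr
    (fun j x hx => chain_deriv P yx hyx0 h1 h2 f x (hUW x hx).2.1 (hfd x hx) j)
    (fun x hx => by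
      rw [hF0]
      exact ⟨(hUW x hx).2.2.2.1.1.le, (hUW x hx).2.2.2.1.2.le⟩)
    (by
      intro j hj
      by_cases hdvd : P ∣ yx j
      · left
        intro x hx
        obtain ⟨g, hg⟩ := hdvd
        simp only [F]
        rw [hg, evalRR_mul, (hUW x hx).1, zero_mul, zero_div]
      · right
        intro x hx
        exact div_ne_zero ((hUW x hx).2.2.2.2 j (Finset.mem_range.2 (by omega)) hdvd)
          (pow_ne_zero _ (hUW x hx).2.1))
    H (by linarith)
  refine ⟨s.card, hs1, fun i => (s.equivFin.symm i : MvPolynomial (Fin 2) ℝ), ?_, ?_⟩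
  · intro i
    exact hs2 _ (s.equivFin.symm i).2
  · intro p hp hq
    rw [hΓ] at hp
    have hp' := connectedComponentIn_mono p₀ hSW hp
    obtain ⟨hpU, hpf⟩ := hcomp p hp'
    have e : p = (p.1, F 0 p.1) := by rw [hF0, hpf]
    obtain ⟨Q, hQ, hQ0⟩ := hs3 p.1 hpU (by rw [← e]; exact hq)
    refine ⟨s.equivFin ⟨Q, hQ⟩, ?_⟩
    simp only [Equiv.symm_apply_apply]
    rw [e]; exact hQ0
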